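/- Every generalized barbell has a signed circuit double cover. -/

import Mathlib

open scoped Classical

noncomputable section

/-- A signed (multi)graph: a finite multigraph (loops and multiple edges allowed)
together with a sign on each edge (`neg e = true` means `e` is negative). -/
structure SignedMultigraph where
  V : Type
  E : Type
  [fintypeV : Fintype V]
  [fintypeE : Fintype E]
  ends : E → Sym2 V
  neg : E → Bool

attribute [instance] SignedMultigraph.fintypeV SignedMultigraph.fintypeE

namespace SignedMultigraph

variable (G : SignedMultigraph)

/-- The vertices incident with at least one edge of `S`. -/
def support (S : Finset G.E) : Finset G.V :=
  Finset.univ.filter fun v => ∃ e ∈ S, v ∈ G.ends e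

/-- Degree of `v` in the edge set `S`; loops count twice. -/
def degIn (S : Finset G.E) (v : G.V) : ℕ :=
  ∑ e ∈ S, (if G.ends e = Sym2.diag v then 2 else if v ∈ G.ends e then 1 else 0)

/-- `u` and `v` are joined by an edge of `S`. -/
def Adj (S : Finset G.E) (u v : G.V) : Prop := ∃ e ∈ S, G.ends e = s(u, v)

/-- Reachability using only edges of `S`. -/
def Reach (S : Finset G.E) : G.V → G.V → Prop := Relation.ReflTransGen (G.Adj S)

/-- The subgraph with edge set `S` (and vertex set its support) is connected. -/
def ConnOn (S : Finset G.E) : Prop :=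
  ∀ u ∈ G.support S, ∀ v ∈ G.support S, G.Reach S u v

/-- The whole signed graph is connected. -/
def Connected : Prop := Nonempty G.V ∧ ∀ u v : G.V, G.Reach Finset.univ u v

/-- The negative edges among `S`. -/
def negEdges (S : Finset G.E) : Finset G.E := S.filter fun e => G.neg e = true

/-- A circuit: a (nonempty) connected 2-regular subgraph, given by its edge set. -/
def IsCircuit (S : Finset G.E) : Prop :=
  S.Nonempty ∧ G.ConnOn S ∧ ∀ v ∈ G.support S, G.degIn S v = 2

/-- A balanced circuit: a circuit with an even number of negative edges. -/
def IsBalancedCircuit (S : Finset G.E) : Prop :=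
  G.IsCircuit S ∧ Even (G.negEdges S).card

/-- An unbalanced circuit: a circuit with an odd number of negative edges. -/
def IsUnbalancedCircuit (S : Finset G.E) : Prop :=
  G.IsCircuit S ∧ ¬ Even (G.negEdges S).card

/-- A short barbell: two unbalanced circuits meeting at exactly one vertex. -/
def IsShortBarbell (S : Finset G.E) : Prop :=
  ∃ C₁ C₂ : Finset G.E, G.IsUnbalancedCircuit C₁ ∧ G.IsUnbalancedCircuit C₂ ∧
    Disjoint C₁ C₂ ∧ (G.support C₁ ∩ G.support C₂).card = 1 ∧ S = C₁ ∪ C₂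

/-- A path with (distinct) ends `u` and `v`, given by its edge set. -/
def IsPath (P : Finset G.E) (u v : G.V) : Prop :=
  P.Nonempty ∧ G.ConnOn P ∧ u ≠ v ∧ u ∈ G.support P ∧ v ∈ G.support P ∧
    G.degIn P u = 1 ∧ G.degIn P v = 1 ∧
    ∀ w ∈ G.support P, w ≠ u → w ≠ v → G.degIn P w = 2

/-- A long barbell: two vertex-disjoint unbalanced circuits joined by a path
meeting the circuits only at its ends. -/
def IsLongBarbell (S : Finset G.E) : Prop :=
  ∃ (C₁ C₂ P : Finset G.E) (u v : G.V),
    G.IsUnbalancedCircuit C₁ ∧ G.IsUnbalancedCircuit C₂ ∧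
    Disjoint (G.support C₁) (G.support C₂) ∧
    G.IsPath P u v ∧
    G.support P ∩ G.support C₁ = {u} ∧ G.support P ∩ G.support C₂ = {v} ∧
    Disjoint P C₁ ∧ Disjoint P C₂ ∧
    S = C₁ ∪ C₂ ∪ P

/-- A signed circuit: a balanced circuit, a short barbell, or a long barbell. -/
def IsSignedCircuit (S : Finset G.E) : Prop :=
  G.IsBalancedCircuit S ∨ G.IsShortBarbell S ∨ G.IsLongBarbell S

/-- The number of members of the family `F` containing the edge `e`. -/
def coverCount (F : Multiset (Finset G.E)) (e : G.E) : ℕ :=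
  (F.filter fun S => e ∈ S).card

/-- The total length of the family `F`. -/
def coverLength (F : Multiset (Finset G.E)) : ℕ := (F.map Finset.card).sum

/-- A signed circuit cover: every edge is in at least one member. -/
def IsSignedCircuitCover (F : Multiset (Finset G.E)) : Prop :=
  (∀ S ∈ F, G.IsSignedCircuit S) ∧ ∀ e : G.E, 1 ≤ G.coverCount F e

/-- The length of a shortest signed circuit cover. -/
def SCC : ℕ := sInf { n | ∃ F, G.IsSignedCircuitCover F ∧ G.coverLength F = n }

/-- Whether edge `e` has exactly one endpoint in the vertex set `A`. -/
def crossesB (A : Finset G.V) (e : G.E) : Bool :=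
  Sym2.lift ⟨fun x y => Bool.xor (decide (x ∈ A)) (decide (y ∈ A)),
    fun x y => Bool.xor_comm _ _⟩ (G.ends e)

/-- Sign of `e` (`true` = negative) after switching at every vertex of `A`. -/
def negAfter (A : Finset G.V) (e : G.E) : Bool :=
  Bool.xor (G.neg e) (G.crossesB A e)

/-- Minimum number of negative edges in `S` over all switchings. -/
def negOf (S : Finset G.E) : ℕ :=
  sInf { n | ∃ A : Finset G.V, (S.filter fun e => G.negAfter A e = true).card = n }

/-- The negativeness of `G`. -/
def negativeness : ℕ := G.negOf Finset.univ

/-- The edges of `S` with exactly one endpoint in `U`: the edge boundary `δ(U)` inside `S`. -/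
def boundary (S : Finset G.E) (U : Finset G.V) : Finset G.E :=
  S.filter fun e => G.crossesB U e = true

/-- `b` is a bridge of the subgraph with edge set `S`. -/
def IsBridge (S : Finset G.E) (b : G.E) : Prop :=
  ∃ U : Finset G.V, G.boundary S U = {b}

/-- The subgraph with edge set `S` is bridgeless. -/
def Bridgeless (S : Finset G.E) : Prop := ∀ b ∈ S, ¬ G.IsBridge S b

/-- `G` is 2-edge-connected. -/
def TwoEdgeConnected : Prop :=
  G.Connected ∧ ∀ b : G.E, ¬ G.IsBridge Finset.univ b

/-- Edges of `S` lying in the same component (of the subgraph with edge set `S`)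
as the vertex `x`. -/
def compEdges (S : Finset G.E) (x : G.V) : Finset G.E :=
  S.filter fun e => ∃ u, u ∈ G.ends e ∧ G.Reach S x u

/-- A g-bridge: a bridge such that both components of `G - b` have even negativeness. -/
def IsGBridge (b : G.E) : Prop :=
  G.IsBridge Finset.univ b ∧
    ∃ x y : G.V, G.ends b = s(x, y) ∧
      Even (G.negOf (G.compEdges (Finset.univ.erase b) x)) ∧
      Even (G.negOf (G.compEdges (Finset.univ.erase b) y))

/-- `G` has no g-bridge (in any of its components). -/
def GBridgeless : Prop := ∀ b : G.E, ¬ G.IsGBridge b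

/-- Member of `B_g(G)`: a bridge such that at least one component of `G - b`
contains an odd number of negative edges. -/
def IsBgBridge (b : G.E) : Prop :=
  G.IsBridge Finset.univ b ∧
    ∃ x : G.V, x ∈ G.ends b ∧
      ¬ Even (G.negEdges (G.compEdges (Finset.univ.erase b) x)).card

/-- Member of `B_s(G)`: a bridge such that each of the two components of `G - b`
contains a negative edge. -/
def IsSBridge (b : G.E) : Prop :=
  G.IsBridge Finset.univ b ∧
    ∃ x y : G.V, G.ends b = s(x, y) ∧
      (G.negEdges (G.compEdges (Finset.univ.erase b) x)).Nonempty ∧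
      (G.negEdges (G.compEdges (Finset.univ.erase b) y)).Nonempty

/-- `G` is s-bridgeless: every edge lies in some signed circuit. -/
def SBridgeless : Prop := ∀ e : G.E, ∃ S : Finset G.E, G.IsSignedCircuit S ∧ e ∈ S

/-- `{e, f}` is a 2-edge-cut of `G`. -/
def IsTwoEdgeCut (e f : G.E) : Prop :=
  e ≠ f ∧ ∃ U : Finset G.V, G.boundary Finset.univ U = {e, f}

/-- `S_G(e) = {e} ∪ {f : {e,f} is a 2-edge-cut of G}`. -/
def SSet (e : G.E) : Finset G.E :=
  insert e (Finset.univ.filter fun f => G.IsTwoEdgeCut e f)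

/-- The edge set `R` spans an acyclic subgraph (every nonempty subset has a
vertex of degree one). -/
def AcyclicSet (R : Finset G.E) : Prop :=
  ∀ F ⊆ R, F.Nonempty → ∃ v : G.V, G.degIn F v = 1

/-- `T` is the edge set of a spanning tree of `G`. -/
def IsSpanningTree (T : Finset G.E) : Prop :=
  G.AcyclicSet T ∧ Nonempty G.V ∧ ∀ u v : G.V, G.Reach T u v

/-- `G` is eulerian: connected with all degrees even. -/
def Eulerian : Prop :=
  G.Connected ∧ ∀ v : G.V, Even (G.degIn Finset.univ v)

/-- The edge set `S` spans an eulerian subgraph. -/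
def IsEulerianSub (S : Finset G.E) : Prop :=
  S.Nonempty ∧ G.ConnOn S ∧ ∀ v ∈ G.support S, Even (G.degIn S v)

/-- The vertex class of `v` after contracting each member of `ℬ`. -/
def classOf (ℬ : Finset (Finset G.E)) (v : G.V) : Finset G.V :=
  Finset.univ.filter fun u => u = v ∨ ∃ B ∈ ℬ, v ∈ G.support B ∧ u ∈ G.support B

/-- Degree, in edge set `F`, of the contracted class of `v`. -/
def classDeg (ℬ : Finset (Finset G.E)) (F : Finset G.E) (v : G.V) : ℕ :=
  ∑ u ∈ G.classOf ℬ v, G.degIn F u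

/-- `ℬ` witnesses that the subgraph with edge set `S` is a generalized barbell:
`ℬ` is a family of vertex-disjoint eulerian subgraphs of `S`, the contraction
`S/(∪ℬ)` is acyclic, and for every vertex `x` of the contracted graph,
`|E_N(B_x)| ≡ |δ(V(B_x))| (mod 2)`. -/
def GenBarbellWitness (S : Finset G.E) (ℬ : Finset (Finset G.E)) : Prop :=
  (∀ B ∈ ℬ, B ⊆ S ∧ G.IsEulerianSub B) ∧
  (∀ B₁ ∈ ℬ, ∀ B₂ ∈ ℬ, B₁ ≠ B₂ → Disjoint (G.support B₁) (G.support B₂)) ∧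
  (∀ F ⊆ S \ ℬ.sup id, F.Nonempty → ∃ v : G.V, G.classDeg ℬ F v = 1) ∧
  (∀ B ∈ ℬ, (G.negEdges B).card ≡ (G.boundary S (G.support B)).card [MOD 2]) ∧
  (∀ v ∈ G.support S, (∀ B ∈ ℬ, v ∉ G.support B) → Even (G.boundary S {v}).card)

/-- The subgraph with edge set `S` is a generalized barbell. -/
def IsGenBarbell (S : Finset G.E) : Prop := ∃ ℬ, G.GenBarbellWitness S ℬ

variable {G}

/-- The number of times `v` occurs as an end of `e`. -/
def inc (G : SignedMultigraph) (e : G.E) (v : G.V) : ℕ :=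
  if G.ends e = Sym2.diag v then 2 else if v ∈ G.ends e then 1 else 0

theorem degIn_eq_sum_inc (S : Finset G.E) (v : G.V) : G.degIn S v = ∑ e ∈ S, G.inc e v := rfl

theorem inc_eq_zero {e : G.E} {v : G.V} : G.inc e v = 0 ↔ v ∉ G.ends e := by
  unfold inc
  split_ifs with h1 h2
  · simp [h1, Sym2.diag]
  · simp [h2]
  · simp [h2]

theorem mem_support {S : Finset G.E} {v : G.V} :
    v ∈ G.support S ↔ ∃ e ∈ S, v ∈ G.ends e := by simp [support]

theorem mem_support_of_mem {S : Finset G.E} {v : G.V} {e : G.E} (he : e ∈ S)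
    (hv : v ∈ G.ends e) : v ∈ G.support S := mem_support.2 ⟨e, he, hv⟩

theorem support_mono {S T : Finset G.E} (h : S ⊆ T) : G.support S ⊆ G.support T := by
  intro v hv
  obtain ⟨e, he, hv⟩ := mem_support.1 hv
  exact mem_support_of_mem (h he) hv

theorem support_union (S T : Finset G.E) : G.support (S ∪ T) = G.support S ∪ G.support T := by
  ext v
  simp only [mem_support, Finset.mem_union]
  constructor
  · rintro ⟨e, h | h, hv⟩
    exacts [Or.inl ⟨e, h, hv⟩, Or.inr ⟨e, h, hv⟩]
  · rintro (⟨e, h, hv⟩ | ⟨e, h, hv⟩)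
    exacts [⟨e, Or.inl h, hv⟩, ⟨e, Or.inr h, hv⟩]

theorem mem_support_singleton {e : G.E} {v : G.V} : v ∈ G.support {e} ↔ v ∈ G.ends e := by
  simp [mem_support]

theorem support_nonempty {S : Finset G.E} (h : S.Nonempty) : (G.support S).Nonempty := by
  obtain ⟨e, he⟩ := h
  exact ⟨(G.ends e).out.1, mem_support_of_mem he (Sym2.out_fst_mem _)⟩

theorem degIn_eq_zero {S : Finset G.E} {v : G.V} : G.degIn S v = 0 ↔ v ∉ G.support S := by
  rw [degIn_eq_sum_inc, Finset.sum_eq_zero_iff, mem_support]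
  simp only [inc_eq_zero]
  push Not
  rfl

theorem degIn_union {S T : Finset G.E} (h : Disjoint S T) (v : G.V) :
    G.degIn (S ∪ T) v = G.degIn S v + G.degIn T v := Finset.sum_union h

theorem degIn_sdiff_add {S A : Finset G.E} (h : A ⊆ S) (v : G.V) :
    G.degIn (S \ A) v + G.degIn A v = G.degIn S v := Finset.sum_sdiff h

theorem degIn_singleton (e : G.E) (v : G.V) : G.degIn {e} v = G.inc e v := by
  simp [degIn_eq_sum_inc]

theorem sum_inc (e : G.E) : ∑ v, G.inc e v = 2 := by
  obtain ⟨x, y, h⟩ : ∃ x y, G.ends e = s(x, y) :=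
    Sym2.inductionOn (G.ends e) fun x y => ⟨x, y, rfl⟩
  by_cases hxy : x = y
  · subst hxy
    rw [Finset.sum_eq_single x]
    · simp [inc, h, Sym2.diag]
    · intro b _ hb
      rw [inc_eq_zero, h]; simp [hb]
    · simp
  · rw [← Finset.sum_subset (Finset.subset_univ {x, y}), Finset.sum_pair hxy]
    · simp [inc, h, Sym2.diag, hxy, Ne.symm hxy]
    · intro b _ hb
      rw [inc_eq_zero, h]; simpa using hb

theorem sum_degIn (S : Finset G.E) : ∑ v, G.degIn S v = 2 * S.card := by
  simp only [degIn_eq_sum_inc]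
  rw [Finset.sum_comm, Finset.sum_congr rfl fun e _ => sum_inc e]
  simp [mul_comm]

theorem inc_link {e : G.E} {x y : G.V} (h : G.ends e = s(x, y)) (hxy : x ≠ y) (v : G.V) :
    G.inc e v = if v = x ∨ v = y then 1 else 0 := by
  have : s(x, y) ≠ Sym2.diag v := by
    intro h
    have := Sym2.eq_iff.1 h
    grind
  simp [inc, h, this]

theorem inc_loop {e : G.E} {x : G.V} (h : G.ends e = Sym2.diag x) (v : G.V) :
    G.inc e v = if v = x then 2 else 0 := by
  by_cases hv : v = x
  · simp [inc, h, hv]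
  · simp only [hv, if_false]
    rw [inc_eq_zero, h]
    simpa [Sym2.diag] using hv

/-- `l` is a negative loop at `w`. -/
def negLoop (G : SignedMultigraph) (w : G.V) (l : G.E) : Prop :=
  G.ends l = Sym2.diag w ∧ G.neg l = true

theorem support_loop {l : G.E} {w : G.V} (h : G.ends l = Sym2.diag w) : G.support {l} = {w} := by
  ext v; simp [mem_support_singleton, h, Sym2.diag]

/-! ### Reachability -/

theorem Adj.symm {S : Finset G.E} {u v : G.V} (h : G.Adj S u v) : G.Adj S v u := by
  obtain ⟨e, he, h⟩ := h
  exact ⟨e, he, h.trans Sym2.eq_swap⟩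

theorem Reach.symm {S : Finset G.E} {u v : G.V} (h : G.Reach S u v) : G.Reach S v u := by
  induction h with
  | refl => exact .refl
  | tail _ hbc ih => exact .head hbc.symm ih

theorem Reach.mono {S T : Finset G.E} (hST : S ⊆ T) {u v : G.V} (h : G.Reach S u v) :
    G.Reach T u v := by
  induction h with
  | refl => exact .refl
  | tail _ hbc ih =>
    obtain ⟨e, he, h⟩ := hbc
    exact .tail ih ⟨e, hST he, h⟩

theorem Reach.trans {S : Finset G.E} {u v w : G.V} (h : G.Reach S u v) (h' : G.Reach S v w) :
    G.Reach S u w := Relation.ReflTransGen.trans h h'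

theorem reach_of_mem {S : Finset G.E} {e : G.E} (he : e ∈ S) {u v : G.V} (hu : u ∈ G.ends e)
    (hv : v ∈ G.ends e) : G.Reach S u v := by
  by_cases huv : u = v
  · subst huv; exact .refl
  · exact .single ⟨e, he, (Sym2.mem_and_mem_iff huv).1 ⟨hu, hv⟩⟩

theorem Adj.mem_left {S : Finset G.E} {u v : G.V} (h : G.Adj S u v) : u ∈ G.support S := by
  obtain ⟨e, he, h⟩ := h
  exact mem_support_of_mem he (by simp [h])

theorem Reach.mem_support_left {S : Finset G.E} {u v : G.V} (h : G.Reach S u v) (huv : u ≠ v) :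
    u ∈ G.support S := by
  rcases Relation.ReflTransGen.cases_head h with h | ⟨w, h, -⟩
  · exact absurd h huv
  · exact h.mem_left

theorem Reach.mem_support {S : Finset G.E} {u v : G.V} (h : G.Reach S u v)
    (hu : u ∈ G.support S) : v ∈ G.support S := by
  by_cases huv : u = v
  · rwa [← huv]
  · exact h.symm.mem_support_left (Ne.symm huv)

theorem ConnOn.union {S T : Finset G.E} (hS : G.ConnOn S) (hT : G.ConnOn T) {w : G.V}
    (hwS : w ∈ G.support S) (hwT : w ∈ G.support T) : G.ConnOn (S ∪ T) := by
  have key : ∀ u ∈ G.support (S ∪ T), G.Reach (S ∪ T) u w := by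
    intro u hu
    rw [support_union, Finset.mem_union] at hu
    rcases hu with hu | hu
    · exact (hS u hu w hwS).mono Finset.subset_union_left
    · exact (hT u hu w hwT).mono Finset.subset_union_right
  intro u hu v hv
  exact (key u hu).trans (key v hv).symm

theorem connOn_singleton (e : G.E) : G.ConnOn {e} := by
  intro u hu v hv
  exact reach_of_mem (Finset.mem_singleton_self e) (mem_support_singleton.1 hu)
    (mem_support_singleton.1 hv)

theorem compEdges_subset (S : Finset G.E) (x : G.V) : G.compEdges S x ⊆ S :=
  Finset.filter_subset _ _

theorem mem_compEdges {S : Finset G.E} {x : G.V} {e : G.E} :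
    e ∈ G.compEdges S x ↔ e ∈ S ∧ ∃ u, u ∈ G.ends e ∧ G.Reach S x u := by
  simp [compEdges]

theorem mem_compEdges_of_mem {S : Finset G.E} {x v : G.V} {e : G.E} (he : e ∈ S)
    (hv : v ∈ G.ends e) (h : G.Reach S x v) : e ∈ G.compEdges S x :=
  mem_compEdges.2 ⟨he, v, hv, h⟩

theorem reach_of_mem_compEdges {S : Finset G.E} {x v : G.V} {e : G.E}
    (he : e ∈ G.compEdges S x) (hv : v ∈ G.ends e) : G.Reach S x v := by
  obtain ⟨he, u, hu, h⟩ := mem_compEdges.1 he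
  exact h.trans (reach_of_mem he hu hv)

theorem Reach.compEdges {S : Finset G.E} {x v : G.V} (h : G.Reach S x v) :
    G.Reach (G.compEdges S x) x v := by
  induction h with
  | refl => exact .refl
  | tail hb hbc ih =>
    obtain ⟨e, he, hee⟩ := hbc
    exact ih.trans (.single ⟨e, mem_compEdges_of_mem he (by simp [hee]) hb, hee⟩)

theorem connOn_compEdges (S : Finset G.E) (x : G.V) : G.ConnOn (G.compEdges S x) := by
  have key : ∀ u ∈ G.support (G.compEdges S x), G.Reach (G.compEdges S x) x u := by
    intro u hu
    obtain ⟨e, he, hu⟩ := SignedMultigraph.mem_support.1 hu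
    exact (reach_of_mem_compEdges he hu).compEdges
  intro u hu v hv
  exact (key u hu).symm.trans (key v hv)

theorem degIn_compEdges_of_reach {S : Finset G.E} {x v : G.V} (h : G.Reach S x v) :
    G.degIn (G.compEdges S x) v = G.degIn S v := by
  rw [degIn_eq_sum_inc, degIn_eq_sum_inc]
  refine Finset.sum_subset (compEdges_subset S x) fun e he hne => ?_
  rw [inc_eq_zero]
  exact fun hv => hne (mem_compEdges_of_mem he hv h)

theorem degIn_compEdges_of_not_reach {S : Finset G.E} {x v : G.V} (h : ¬ G.Reach S x v) :
    G.degIn (G.compEdges S x) v = 0 := by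
  rw [degIn_eq_zero, SignedMultigraph.mem_support]
  rintro ⟨e, he, hv⟩
  exact h (reach_of_mem_compEdges he hv)

theorem even_degIn_compEdges {S : Finset G.E} {x v : G.V} (h : Even (G.degIn S v)) :
    Even (G.degIn (G.compEdges S x) v) := by
  by_cases hv : G.Reach S x v
  · rwa [degIn_compEdges_of_reach hv]
  · simp [degIn_compEdges_of_not_reach hv]

/-- Removing a component of `X \ A` from a connected `X` leaves a connected set. -/
theorem connOn_sdiff_compEdges {X A : Finset G.E} (hX : G.ConnOn X) (hA : G.ConnOn A)
    (hAX : A ⊆ X) (hne : A.Nonempty) (x : G.V) : G.ConnOn (X \ G.compEdges (X \ A) x) := by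
  set K := G.compEdges (X \ A) x with hK
  have hAK : A ⊆ X \ K := fun e he => Finset.mem_sdiff.2
    ⟨hAX he, fun h => (Finset.mem_sdiff.1 (compEdges_subset _ _ h)).2 he⟩
  obtain ⟨a, ha⟩ := support_nonempty (G := G) hne
  have walk : ∀ u, G.Reach X u a → (u ∈ G.support A ∨ ¬ G.Reach (X \ A) x u) →
      G.Reach (X \ K) u a := by
    intro u hu
    induction hu using Relation.ReflTransGen.head_induction_on with
    | refl => exact fun _ => .refl
    | head huw hwa ih =>
      rename_i u w
      intro h
      by_cases huA : u ∈ G.support A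
      · exact (hA u huA a ha).mono hAK
      · have hnr := h.resolve_left huA
        obtain ⟨e, he, hee⟩ := huw
        have heA : e ∈ X \ A := Finset.mem_sdiff.2
          ⟨he, fun h => huA (mem_support_of_mem h (by simp [hee]))⟩
        have hwu : G.Reach (X \ A) w u := reach_of_mem heA (by simp [hee]) (by simp [hee])
        refine (Relation.ReflTransGen.single ⟨e, ?_, hee⟩ : G.Reach _ u w).trans
          (ih (Or.inr fun h => hnr (h.trans hwu)))
        refine Finset.mem_sdiff.2 ⟨he, fun h => hnr (reach_of_mem_compEdges h (by simp [hee]))⟩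
  have key : ∀ u ∈ G.support (X \ K), G.Reach (X \ K) u a := by
    intro u hu
    refine walk u (hX u (support_mono Finset.sdiff_subset hu) a (support_mono hAX ha)) ?_
    by_contra! h
    obtain ⟨e, he, hue⟩ := SignedMultigraph.mem_support.1 hu
    obtain ⟨heX, heK⟩ := Finset.mem_sdiff.1 he
    by_cases heA : e ∈ A
    · exact h.1 (mem_support_of_mem heA hue)
    · exact heK (mem_compEdges_of_mem (Finset.mem_sdiff.2 ⟨heX, heA⟩) hue h.2)
  intro u hu v hv
  exact (key u hu).trans (key v hv).symm

/-- If all vertices shared by `A` and `X \ A` are reachable from one vertex inside `X \ A`, then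
`X \ A` is connected. -/
theorem connOn_sdiff {X A : Finset G.E} (hX : G.ConnOn X) {z : G.V}
    (hz : z ∈ G.support (X \ A))
    (h : ∀ w ∈ G.support A, w ∈ G.support (X \ A) → G.Reach (X \ A) w z) :
    G.ConnOn (X \ A) := by
  have walk : ∀ u, G.Reach X u z → u ∈ G.support (X \ A) → G.Reach (X \ A) u z := by
    intro u hu
    induction hu using Relation.ReflTransGen.head_induction_on with
    | refl => exact fun _ => .refl
    | head huw hwa ih =>
      rename_i u w
      intro hu
      by_cases huA : u ∈ G.support A
      · exact h u huA hu
      · obtain ⟨e, he, hee⟩ := huw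
        have heA : e ∈ X \ A := Finset.mem_sdiff.2
          ⟨he, fun h => huA (mem_support_of_mem h (by simp [hee]))⟩
        exact (reach_of_mem heA (by simp [hee]) (by simp [hee])).trans
          (ih (mem_support_of_mem heA (by simp [hee])))
  have key : ∀ u ∈ G.support (X \ A), G.Reach (X \ A) u z := fun u hu =>
    walk u (hX u (support_mono Finset.sdiff_subset hu) z (support_mono Finset.sdiff_subset hz)) hu
  intro u hu v hv
  exact (key u hu).trans (key v hv).symm

/-- A connected set has a vertex in common between any two complementary nonempty parts. -/
theorem ConnOn.exists_common {X A : Finset G.E} (hX : G.ConnOn X) (hAX : A ⊆ X)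
    (hA : A.Nonempty) (hA' : (X \ A).Nonempty) :
    ∃ w, w ∈ G.support A ∧ w ∈ G.support (X \ A) := by
  obtain ⟨a, ha⟩ := support_nonempty (G := G) hA
  obtain ⟨b, hb⟩ := support_nonempty (G := G) hA'
  have hab := hX a (support_mono hAX ha) b (support_mono Finset.sdiff_subset hb)
  clear hA
  induction hab using Relation.ReflTransGen.head_induction_on with
  | refl => exact ⟨b, ha, hb⟩
  | head huw hwa ih =>
    rename_i u w
    obtain ⟨e, he, hee⟩ := huw
    by_cases heA : e ∈ A
    · exact ih (mem_support_of_mem heA (by simp [hee]))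
    · exact ⟨u, ha, mem_support_of_mem (Finset.mem_sdiff.2 ⟨he, heA⟩) (by simp [hee])⟩

/-! ### Joins -/

theorem reach_of_odd {T : Finset G.E} {x y : G.V} (hx : Odd (G.degIn T x))
    (h : ∀ v, v ≠ x → v ≠ y → Even (G.degIn T v)) : G.Reach T x y := by
  by_contra hxy
  have hsum := sum_degIn (G.compEdges T x)
  have hodd : Odd (∑ v, G.degIn (G.compEdges T x) v) := by
    rw [← Finset.add_sum_erase _ _ (Finset.mem_univ x)]
    refine Odd.add_even (by rwa [degIn_compEdges_of_reach .refl]) ?_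
    refine Finset.even_sum _ fun v hv => ?_
    by_cases hvy : v = y
    · subst hvy
      simp [degIn_compEdges_of_not_reach hxy]
    · exact even_degIn_compEdges (h v (Finset.ne_of_mem_erase hv) hvy)
  rw [hsum] at hodd
  exact (Nat.not_even_iff_odd.2 hodd) (even_two_mul _)

theorem exists_join {S : Finset G.E} {x y : G.V} (h : G.Reach S x y) :
    ∃ T ⊆ S, ∀ v, (G.degIn T v : ZMod 2) = (if v = x then 1 else 0) + (if v = y then 1 else 0) := by
  induction h with
  | refl =>
    refine ⟨∅, Finset.empty_subset _, fun v => ?_⟩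
    have : (2 : ZMod 2) = 0 := rfl
    simp only [degIn_eq_sum_inc, Finset.sum_empty]
    split_ifs <;> simp [one_add_one_eq_two, this]
  | tail hxb hbc ih =>
    rename_i b c
    obtain ⟨T, hT, h⟩ := ih
    obtain ⟨e, he, hee⟩ := hbc
    have h2 : (2 : ZMod 2) = 0 := rfl
    have hinc : ∀ v, (G.inc e v : ZMod 2) = (if v = b then 1 else 0) + (if v = c then 1 else 0) := by
      intro v
      by_cases hbc : b = c
      · subst hbc
        rw [inc_loop hee]
        split_ifs <;> simp [h2, one_add_one_eq_two]
      · rw [inc_link hee hbc]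
        split_ifs <;> simp_all
    by_cases heT : e ∈ T
    · refine ⟨T.erase e, (Finset.erase_subset _ _).trans hT, fun v => ?_⟩
      have h1 : (G.degIn (T.erase e) v : ZMod 2) = G.degIn T v - G.inc e v := by
        rw [degIn_eq_sum_inc, degIn_eq_sum_inc, ← Finset.add_sum_erase _ _ heT]
        push_cast; ring
      rw [h1, h, hinc]
      linear_combination - CharTwo.add_self_eq_zero (if v = c then (1 : ZMod 2) else 0)
    · refine ⟨insert e T, Finset.insert_subset he hT, fun v => ?_⟩
      rw [degIn_eq_sum_inc, Finset.sum_insert heT, ← degIn_eq_sum_inc, Nat.cast_add, h, hinc]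
      linear_combination CharTwo.add_self_eq_zero (if v = b then (1 : ZMod 2) else 0)

theorem exists_connOn_join {S : Finset G.E} {x y : G.V} (h : G.Reach S x y) (hxy : x ≠ y) :
    ∃ T ⊆ S, G.ConnOn T ∧ Odd (G.degIn T x) ∧ Odd (G.degIn T y) ∧
      ∀ v, v ≠ x → v ≠ y → Even (G.degIn T v) := by
  obtain ⟨T, hT, h⟩ := exists_join h
  have hx : Odd (G.degIn T x) := by
    rw [← ZMod.natCast_eq_one_iff_odd, h]; simp [hxy]
  have hy : Odd (G.degIn T y) := by
    rw [← ZMod.natCast_eq_one_iff_odd, h]; simp [hxy.symm]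
  have he : ∀ v, v ≠ x → v ≠ y → Even (G.degIn T v) := by
    intro v h1 h2
    rw [← ZMod.natCast_eq_zero_iff_even, h]; simp [h1, h2]
  refine ⟨G.compEdges T x, (compEdges_subset _ _).trans hT, connOn_compEdges _ _, ?_, ?_, ?_⟩
  · rwa [degIn_compEdges_of_reach .refl]
  · rwa [degIn_compEdges_of_reach (reach_of_odd hx he)]
  · exact fun v h1 h2 => even_degIn_compEdges (he v h1 h2)

theorem mem_support_of_odd {S : Finset G.E} {v : G.V} (h : Odd (G.degIn S v)) :
    v ∈ G.support S := by
  by_contra hv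
  rw [degIn_eq_zero.2 hv] at h
  simp at h

/-- A connected even set splits into two connected joins between any two of its vertices. -/
theorem exists_split {X : Finset G.E} (hX : G.ConnOn X) (he : ∀ v, Even (G.degIn X v))
    {x y : G.V} (hx : x ∈ G.support X) (hy : y ∈ G.support X) (hxy : x ≠ y) :
    ∃ A ⊆ X, G.ConnOn A ∧ G.ConnOn (X \ A) ∧ Odd (G.degIn A x) ∧ Odd (G.degIn A y) ∧
      ∀ v, v ≠ x → v ≠ y → Even (G.degIn A v) := by
  obtain ⟨T, hTX, hT, hTx, hTy, hTe⟩ := exists_connOn_join (hX x hx y hy) hxy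
  have par : ∀ v, (Odd (G.degIn (X \ T) v) ↔ Odd (G.degIn T v)) := by
    intro v
    have := degIn_sdiff_add hTX v
    have := he v
    grind
  have hTe' : ∀ v, v ≠ x → v ≠ y → Even (G.degIn (X \ T) v) := by
    intro v h1 h2
    rw [← Nat.not_odd_iff_even, par, Nat.not_odd_iff_even]
    exact hTe v h1 h2
  refine ⟨G.compEdges (X \ T) x, (compEdges_subset _ _).trans Finset.sdiff_subset,
    connOn_compEdges _ _, ?_, ?_, ?_, ?_⟩
  · refine connOn_sdiff_compEdges hX hT hTX ?_ x
    obtain ⟨e, he, -⟩ := mem_support.1 (mem_support_of_odd hTx)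
    exact ⟨e, he⟩
  · rwa [degIn_compEdges_of_reach .refl, par]
  · rwa [degIn_compEdges_of_reach (reach_of_odd ((par x).2 hTx) hTe'), par]
  · exact fun v h1 h2 => even_degIn_compEdges (hTe' v h1 h2)

/-! ### Paths and circuits -/

theorem support_nonempty_of_degIn {S : Finset G.E} {v : G.V} {n : ℕ} (h : G.degIn S v = n + 1) :
    v ∈ G.support S := by
  by_contra hv
  rw [degIn_eq_zero.2 hv] at h
  omega

theorem isPath_of_degIn {P : Finset G.E} {u v : G.V} (hP : G.ConnOn P) (huv : u ≠ v)
    (hu : G.degIn P u = 1) (hv : G.degIn P v = 1)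
    (h : ∀ w ∈ G.support P, w ≠ u → w ≠ v → G.degIn P w = 2) : G.IsPath P u v := by
  have hu' := support_nonempty_of_degIn hu
  obtain ⟨e, he, -⟩ := mem_support.1 hu'
  exact ⟨⟨e, he⟩, hP, huv, hu', support_nonempty_of_degIn hv, hu, hv, h⟩

namespace IsPath

variable {P Q : Finset G.E} {u v w : G.V}

theorem connOn (h : G.IsPath P u v) : G.ConnOn P := h.2.1
theorem ne (h : G.IsPath P u v) : u ≠ v := h.2.2.1
theorem left_mem (h : G.IsPath P u v) : u ∈ G.support P := h.2.2.2.1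
theorem right_mem (h : G.IsPath P u v) : v ∈ G.support P := h.2.2.2.2.1
theorem degIn_left (h : G.IsPath P u v) : G.degIn P u = 1 := h.2.2.2.2.2.1
theorem degIn_right (h : G.IsPath P u v) : G.degIn P v = 1 := h.2.2.2.2.2.2.1
theorem degIn_mid (h : G.IsPath P u v) (hw : w ∈ G.support P) (h1 : w ≠ u) (h2 : w ≠ v) :
    G.degIn P w = 2 := h.2.2.2.2.2.2.2 w hw h1 h2

theorem symm (h : G.IsPath P u v) : G.IsPath P v u :=
  isPath_of_degIn h.connOn h.ne.symm h.degIn_right h.degIn_left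
    fun _ hw h1 h2 => h.degIn_mid hw h2 h1

end IsPath

theorem isPath_singleton {e : G.E} {x y : G.V} (h : G.ends e = s(x, y)) (hxy : x ≠ y) :
    G.IsPath {e} x y := by
  refine isPath_of_degIn (connOn_singleton e) hxy ?_ ?_ ?_
  · rw [degIn_singleton, inc_link h hxy]; simp
  · rw [degIn_singleton, inc_link h hxy]; simp
  · intro w hw h1 h2
    rw [mem_support_singleton, h] at hw
    simp [h1, h2] at hw

/-- An edge all of whose ends are `w` is a loop at `w`. -/
theorem ends_eq_diag {e : G.E} {w : G.V} (h : ∀ v ∈ G.ends e, v = w) :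
    G.ends e = Sym2.diag w := by
  obtain ⟨x, y, hxy⟩ : ∃ x y, G.ends e = s(x, y) :=
    Sym2.inductionOn (G.ends e) fun x y => ⟨x, y, rfl⟩
  rw [hxy] at h ⊢
  rw [h x (by simp), h y (by simp)]
  rfl

theorem inc_le_degIn {S : Finset G.E} {e : G.E} (he : e ∈ S) (v : G.V) :
    G.inc e v ≤ G.degIn S v :=
  Finset.single_le_sum (f := fun e => G.inc e v) (fun _ _ => Nat.zero_le _) he

theorem disjoint_of_support {P Q : Finset G.E} {w : G.V} (hP : G.degIn P w ≤ 1)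
    (h : G.support P ∩ G.support Q ⊆ {w}) : Disjoint P Q := by
  rw [Finset.disjoint_left]
  intro e heP heQ
  have hl : G.ends e = Sym2.diag w := ends_eq_diag fun v hv => Finset.mem_singleton.1
    (h (Finset.mem_inter.2 ⟨mem_support_of_mem heP hv, mem_support_of_mem heQ hv⟩))
  have := inc_le_degIn heP w
  rw [inc_loop hl] at this
  simp at this
  omega

theorem mem_of_inter_eq {A B : Finset G.V} {w : G.V} (h : A ∩ B = {w}) : w ∈ A ∧ w ∈ B := by
  have : w ∈ A ∩ B := by simp [h]
  exact Finset.mem_inter.1 this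

theorem eq_of_inter_eq {A B : Finset G.V} {w x : G.V} (h : A ∩ B = {w}) (hA : x ∈ A)
    (hB : x ∈ B) : x = w := by
  have : x ∈ A ∩ B := Finset.mem_inter.2 ⟨hA, hB⟩
  simpa [h] using this

theorem IsPath.concat {P Q : Finset G.E} {u v w : G.V} (hP : G.IsPath P u w)
    (hQ : G.IsPath Q w v) (h : G.support P ∩ G.support Q = {w}) :
    Disjoint P Q ∧ G.IsPath (P ∪ Q) u v := by
  have hd : Disjoint P Q := disjoint_of_support hP.degIn_right.le h.subset
  have huQ : u ∉ G.support Q := fun hu => hP.ne (eq_of_inter_eq h hP.left_mem hu)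
  have hvP : v ∉ G.support P := fun hv => hQ.ne (eq_of_inter_eq h hv hQ.right_mem).symm
  refine ⟨hd, isPath_of_degIn (hP.connOn.union hQ.connOn hP.right_mem hQ.left_mem) ?_ ?_ ?_ ?_⟩
  · rintro rfl
    exact huQ hQ.right_mem
  · rw [degIn_union hd, hP.degIn_left, degIn_eq_zero.2 huQ]
  · rw [degIn_union hd, hQ.degIn_right, degIn_eq_zero.2 hvP]
  · intro x hx h1 h2
    rw [degIn_union hd]
    by_cases hxw : x = w
    · subst hxw
      rw [hP.degIn_right, hQ.degIn_left]
    · rw [support_union, Finset.mem_union] at hx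
      by_cases hxP : x ∈ G.support P
      · have hxQ : x ∉ G.support Q := fun hxQ => hxw (eq_of_inter_eq h hxP hxQ)
        rw [hP.degIn_mid hxP h1 hxw, degIn_eq_zero.2 hxQ]
      · rw [degIn_eq_zero.2 hxP, hQ.degIn_mid (hx.resolve_left hxP) hxw h2]

theorem IsPath.split {P : Finset G.E} {u v z : G.V} (hP : G.IsPath P u v)
    (hz : z ∈ G.support P) (hzu : z ≠ u) (hzv : z ≠ v) :
    ∃ A ⊆ P, G.IsPath A u z ∧ G.IsPath (P \ A) z v ∧
      G.support A ∩ G.support (P \ A) = {z} := by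
  obtain ⟨A, hAP, hA, hAu, hAz, hAe⟩ := exists_connOn_join (hP.connOn u hP.left_mem z hz) hzu.symm
  have hadd := fun w => degIn_sdiff_add hAP w
  have hu := hadd u
  have hv := hadd v
  have hz' := hadd z
  rw [hP.degIn_left] at hu
  rw [hP.degIn_right] at hv
  rw [hP.degIn_mid hz hzu hzv] at hz'
  have hAv := hAe v hP.ne.symm hzv.symm
  have hmid : ∀ w, w ≠ u → w ≠ v → w ≠ z → w ∈ G.support P →
      (G.degIn A w = 2 ∧ G.degIn (P \ A) w = 0) ∨ (G.degIn A w = 0 ∧ G.degIn (P \ A) w = 2) := by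
    intro w h1 h2 h3 hw
    have := hadd w
    rw [hP.degIn_mid hw h1 h2] at this
    have := hAe w h1 h3
    grind
  have au : G.degIn A u = 1 := by grind
  have bu : G.degIn (P \ A) u = 0 := by grind
  have av : G.degIn A v = 0 := by grind
  have bv : G.degIn (P \ A) v = 1 := by grind
  have az : G.degIn A z = 1 := by grind
  have bz : G.degIn (P \ A) z = 1 := by grind
  have hzA := support_nonempty_of_degIn az
  have hzB := support_nonempty_of_degIn bz
  have common : ∀ w, w ∈ G.support A → w ∈ G.support (P \ A) → w = z := by
    intro w hwA hwB
    by_contra hwz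
    have hwu : w ≠ u := by rintro rfl; exact degIn_eq_zero.1 bu hwB
    have hwv : w ≠ v := by rintro rfl; exact degIn_eq_zero.1 av hwA
    rcases hmid w hwu hwv hwz (support_mono hAP hwA) with h | h
    · exact degIn_eq_zero.1 h.2 hwB
    · exact degIn_eq_zero.1 h.1 hwA
  refine ⟨A, hAP, isPath_of_degIn hA hzu.symm au az ?_, isPath_of_degIn ?_ hzv bz bv ?_, ?_⟩
  · intro w hw h1 h2
    have hwv : w ≠ v := by rintro rfl; exact degIn_eq_zero.1 av hw
    rcases hmid w h1 hwv h2 (support_mono hAP hw) with h | h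
    · exact h.1
    · exact absurd hw (degIn_eq_zero.1 h.1)
  · refine connOn_sdiff hP.connOn hzB fun w h1 h2 => ?_
    rw [common w h1 h2]
    exact .refl
  · intro w hw h1 h2
    have hwu : w ≠ u := by rintro rfl; exact degIn_eq_zero.1 bu hw
    rcases hmid w hwu h2 h1 (support_mono Finset.sdiff_subset hw) with h | h
    · exact absurd hw (degIn_eq_zero.1 h.2)
    · exact h.2
  · ext w
    rw [Finset.mem_inter, Finset.mem_singleton]
    constructor
    · exact fun h => common w h.1 h.2
    · rintro rfl
      exact ⟨hzA, hzB⟩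

theorem exists_isPath {S : Finset G.E} {x y : G.V} (h : G.Reach S x y) (hxy : x ≠ y) :
    ∃ P ⊆ S, G.IsPath P x y := by
  induction h using Relation.ReflTransGen.head_induction_on with
  | refl => exact absurd rfl hxy
  | head hxz hzy ih =>
    rename_i x z
    obtain ⟨e, he, hee⟩ := hxz
    by_cases hz : z = y
    · subst hz
      exact ⟨{e}, by simpa using he, isPath_singleton hee hxy⟩
    obtain ⟨P, hPS, hP⟩ := ih hz
    by_cases hxz : x = z
    · subst hxz; exact ⟨P, hPS, hP⟩
    by_cases hxP : x ∈ G.support P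
    · obtain ⟨A, hAP, -, hA, -⟩ := hP.split hxP hxz hxy
      exact ⟨P \ A, Finset.sdiff_subset.trans hPS, hA⟩
    · refine ⟨{e} ∪ P, Finset.union_subset (by simpa using he) hPS,
        ((isPath_singleton hee hxz).concat hP ?_).2⟩
      ext w
      simp only [Finset.mem_inter, mem_support_singleton, hee, Sym2.mem_iff, Finset.mem_singleton]
      constructor
      · rintro ⟨rfl | rfl, h⟩
        exacts [absurd h hxP, rfl]
      · rintro rfl
        exact ⟨Or.inr rfl, hP.left_mem⟩

theorem exists_isCircuit {S : Finset G.E} (hS : ∀ v, Even (G.degIn S v)) {e : G.E} (he : e ∈ S)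
    {x y : G.V} (hee : G.ends e = s(x, y)) (hxy : x ≠ y) :
    ∃ D ⊆ S, G.IsCircuit D ∧ 2 ≤ D.card := by
  have hdeg : ∀ v, G.degIn (S \ {e}) v + G.inc e v = G.degIn S v := by
    intro v
    rw [← degIn_singleton]
    exact degIn_sdiff_add (by simpa using he) v
  have hr : G.Reach (S \ {e}) x y := by
    refine reach_of_odd ?_ ?_
    · have := hdeg x
      have := hS x
      rw [inc_link hee hxy] at *
      grind
    · intro v h1 h2
      have := hdeg v
      have := hS v
      rw [inc_link hee hxy] at *
      grind
  obtain ⟨P, hPS, hP⟩ := exists_isPath hr hxy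
  have heP : Disjoint P {e} := by
    rw [Finset.disjoint_singleton_right]
    exact fun h => by simpa using hPS h
  refine ⟨P ∪ {e}, Finset.union_subset (hPS.trans Finset.sdiff_subset) (by simpa using he), ⟨?_, ?_, ?_⟩, ?_⟩
  · exact ⟨e, by simp⟩
  · exact hP.connOn.union (connOn_singleton e) hP.left_mem (by simp [mem_support_singleton, hee])
  · intro v hv
    rw [degIn_union heP, degIn_singleton, inc_link hee hxy]
    by_cases h1 : v = x
    · subst h1; simp [hP.degIn_left]
    by_cases h2 : v = y
    · subst h2; simp [hP.degIn_right]
    have : v ∈ G.support P := by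
      rw [support_union, Finset.mem_union, mem_support_singleton, hee] at hv
      simpa [h1, h2] using hv
    simp [h1, h2, hP.degIn_mid this h1 h2]
  · rw [Finset.card_union_of_disjoint heP]
    have := hP.1.card_pos
    rw [Finset.card_singleton]
    omega

theorem IsCircuit.even_degIn {D : Finset G.E} (h : G.IsCircuit D) (v : G.V) :
    Even (G.degIn D v) := by
  by_cases hv : v ∈ G.support D
  · rw [h.2.2 v hv]; exact even_two
  · rw [degIn_eq_zero.2 hv]; exact Even.zero

theorem IsCircuit.split {D : Finset G.E} (hD : G.IsCircuit D) {u v : G.V}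
    (hu : u ∈ G.support D) (hv : v ∈ G.support D) (huv : u ≠ v) :
    ∃ A ⊆ D, G.IsPath A u v ∧ G.IsPath (D \ A) u v ∧
      ∀ w, w ∈ G.support A → w ∈ G.support (D \ A) → w = u ∨ w = v := by
  obtain ⟨A, hAD, hA, hB, hAu, hAv, hAe⟩ := exists_split hD.2.1 hD.even_degIn hu hv huv
  have hadd := fun w => degIn_sdiff_add hAD w
  have hu' := hadd u
  have hv' := hadd v
  rw [hD.2.2 u hu] at hu'
  rw [hD.2.2 v hv] at hv'
  have hmid : ∀ w, w ≠ u → w ≠ v → w ∈ G.support D →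
      (G.degIn A w = 2 ∧ G.degIn (D \ A) w = 0) ∨ (G.degIn A w = 0 ∧ G.degIn (D \ A) w = 2) := by
    intro w h1 h2 hw
    have := hadd w
    rw [hD.2.2 w hw] at this
    have := hAe w h1 h2
    grind
  refine ⟨A, hAD, isPath_of_degIn hA huv (by grind) (by grind) ?_,
    isPath_of_degIn hB huv (by grind) (by grind) ?_, ?_⟩
  · intro w hw h1 h2
    rcases hmid w h1 h2 (support_mono hAD hw) with h | h
    · exact h.1
    · exact absurd hw (degIn_eq_zero.1 h.1)
  · intro w hw h1 h2
    rcases hmid w h1 h2 (support_mono Finset.sdiff_subset hw) with h | h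
    · exact absurd hw (degIn_eq_zero.1 h.2)
    · exact h.2
  · intro w hwA hwB
    by_contra! hw
    rcases hmid w hw.1 hw.2 (support_mono hAD hwA) with h | h
    · exact degIn_eq_zero.1 h.2 hwB
    · exact degIn_eq_zero.1 h.1 hwA

/-! ### Tadpoles -/

theorem negEdges_singleton {l : G.E} {w : G.V} (h : G.negLoop w l) : G.negEdges {l} = {l} := by
  simp [negEdges, Finset.filter_singleton, h.2]

theorem isCircuit_loop {l : G.E} {w : G.V} (h : G.ends l = Sym2.diag w) : G.IsCircuit {l} := by
  refine ⟨by simp, connOn_singleton l, fun v hv => ?_⟩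
  rw [support_loop h, Finset.mem_singleton] at hv
  rw [degIn_singleton, inc_loop h, if_pos hv]

theorem isUnbalancedCircuit_loop {l : G.E} {w : G.V} (h : G.negLoop w l) :
    G.IsUnbalancedCircuit {l} := by
  refine ⟨isCircuit_loop h.1, ?_⟩
  rw [negEdges_singleton h]
  simp

/-- A connected set in which a loop exhausts the degree of its vertex is just that loop. -/
theorem ConnOn.eq_loop {S : Finset G.E} (hS : G.ConnOn S) {l : G.E} {w : G.V} (hl : l ∈ S)
    (h : G.ends l = Sym2.diag w) (hd : G.degIn S w = 2) : S = {l} := by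
  by_contra hne
  have hsub : ({l} : Finset G.E) ⊆ S := by simpa using hl
  obtain ⟨x, hx1, hx2⟩ := hS.exists_common hsub (by simp)
    (Finset.sdiff_nonempty.2 fun h => hne (h.antisymm hsub))
  rw [support_loop h, Finset.mem_singleton] at hx1
  subst hx1
  have := degIn_sdiff_add hsub x
  rw [hd, degIn_singleton, inc_loop h, if_pos rfl] at this
  exact degIn_eq_zero.1 (by omega) hx2

/-- A tadpole with root `w`: an unbalanced circuit together with a possibly trivial path
from `w` that meets the circuit only at its other end. -/
def IsTadpole (G : SignedMultigraph) (T : Finset G.E) (w : G.V) : Prop :=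
  ∃ C, G.IsUnbalancedCircuit C ∧ ((w ∈ G.support C ∧ T = C) ∨
    ∃ P v, G.IsPath P w v ∧ G.support P ∩ G.support C = {v} ∧ T = C ∪ P)

theorem IsUnbalancedCircuit.isTadpole {C : Finset G.E} {w : G.V} (hC : G.IsUnbalancedCircuit C)
    (hw : w ∈ G.support C) : G.IsTadpole C w := ⟨C, hC, Or.inl ⟨hw, rfl⟩⟩

theorem isTadpole_loop {l : G.E} {w : G.V} (h : G.negLoop w l) : G.IsTadpole {l} w :=
  (isUnbalancedCircuit_loop h).isTadpole (by simp [support_loop h.1])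

theorem IsTadpole.root_mem {T : Finset G.E} {w : G.V} (h : G.IsTadpole T w) :
    w ∈ G.support T := by
  obtain ⟨C, -, ⟨h, rfl⟩ | ⟨P, v, hP, -, rfl⟩⟩ := h
  · exact h
  · rw [support_union]
    exact Finset.mem_union_right _ hP.left_mem

/-- Lengthening the stem of a tadpole. -/
theorem IsTadpole.extend {T Q : Finset G.E} {x y : G.V} (hT : G.IsTadpole T x)
    (hQ : G.IsPath Q y x) (h : G.support Q ∩ G.support T = {x}) : G.IsTadpole (T ∪ Q) y := by
  obtain ⟨C, hC, ⟨hx, rfl⟩ | ⟨P, v, hP, hPC, rfl⟩⟩ := hT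
  · exact ⟨T, hC, Or.inr ⟨Q, x, hQ, h, rfl⟩⟩
  · rw [support_union] at h
    refine ⟨C, hC, Or.inr ⟨Q ∪ P, v, (hQ.concat hP ?_).2, ?_, ?_⟩⟩
    · ext w
      rw [Finset.mem_inter, Finset.mem_singleton]
      constructor
      · exact fun hw => eq_of_inter_eq h hw.1 (Finset.mem_union_right _ hw.2)
      · rintro rfl
        exact ⟨hQ.right_mem, hP.left_mem⟩
    · ext w
      rw [support_union, Finset.mem_inter, Finset.mem_singleton, Finset.mem_union]
      constructor
      · rintro ⟨hw | hw, hwC⟩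
        · have := eq_of_inter_eq h hw (Finset.mem_union_left _ hwC)
          subst this
          exact eq_of_inter_eq hPC hP.left_mem hwC
        · exact eq_of_inter_eq hPC hw hwC
      · rintro rfl
        exact ⟨Or.inr hP.right_mem, (mem_of_inter_eq hPC).2⟩
    · ext; simp; tauto

theorem IsTadpole.glue_circuit {T C : Finset G.E} {w : G.V} (hT : G.IsTadpole T w)
    (hC : G.IsUnbalancedCircuit C) (hd : Disjoint T C) (h : G.support T ∩ G.support C = {w}) :
    G.IsSignedCircuit (T ∪ C) := by
  obtain ⟨C', hC', ⟨hx, rfl⟩ | ⟨P, v, hP, hPC, rfl⟩⟩ := hT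
  · exact Or.inr (Or.inl ⟨T, C, hC', hC, hd, by rw [h]; simp, rfl⟩)
  · rw [support_union] at h
    rw [Finset.disjoint_union_left] at hd
    have hwC' : w ∉ G.support C' := fun hw => hP.ne (eq_of_inter_eq hPC hP.left_mem hw)
    refine Or.inr (Or.inr ⟨C', C, P, v, w, hC', hC, ?_, hP.symm, hPC, ?_, ?_, hd.2, ?_⟩)
    · rw [Finset.disjoint_left]
      intro a ha haC
      have := eq_of_inter_eq h (Finset.mem_union_left _ ha) haC
      subst this
      exact hwC' ha
    · ext a
      rw [Finset.mem_inter, Finset.mem_singleton]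
      constructor
      · exact fun ha => eq_of_inter_eq h (Finset.mem_union_right _ ha.1) ha.2
      · rintro rfl
        exact ⟨hP.left_mem, (mem_of_inter_eq h).2⟩
    · exact disjoint_of_support hP.degIn_right.le hPC.subset
    · ext; simp; tauto

/-- Two tadpoles meeting exactly in their common root form a signed circuit. -/
theorem IsTadpole.glue {T T' : Finset G.E} {w : G.V} (hT : G.IsTadpole T w)
    (hT' : G.IsTadpole T' w) (hd : Disjoint T T') (h : G.support T ∩ G.support T' = {w}) :
    G.IsSignedCircuit (T ∪ T') := by
  obtain ⟨C, hC, ⟨hx, rfl⟩ | ⟨P, v, hP, hPC, rfl⟩⟩ := hT'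
  · exact hT.glue_circuit hC hd h
  · rw [support_union] at h
    rw [Finset.disjoint_union_right] at hd
    have hwC : w ∉ G.support C := fun hw => hP.ne (eq_of_inter_eq hPC hP.left_mem hw)
    have hTP : G.IsTadpole (T ∪ P) v := by
      refine hT.extend hP.symm ?_
      ext a
      rw [Finset.mem_inter, Finset.mem_singleton]
      constructor
      · exact fun ha => eq_of_inter_eq h ha.2 (Finset.mem_union_right _ ha.1)
      · rintro rfl
        exact ⟨hP.left_mem, hT.root_mem⟩
    have : T ∪ (C ∪ P) = T ∪ P ∪ C := by ext; simp; tauto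
    rw [this]
    refine hTP.glue_circuit hC ?_ ?_
    · rw [Finset.disjoint_union_left]
      exact ⟨hd.1, disjoint_of_support hP.degIn_right.le hPC.subset⟩
    · ext a
      rw [support_union, Finset.mem_inter, Finset.mem_singleton, Finset.mem_union]
      constructor
      · rintro ⟨ha | ha, haC⟩
        · have := eq_of_inter_eq h ha (Finset.mem_union_left _ haC)
          subst this
          exact absurd haC hwC
        · exact eq_of_inter_eq hPC ha haC
      · rintro rfl
        exact ⟨Or.inr hP.right_mem, (mem_of_inter_eq hPC).2⟩

theorem IsPath.not_loop {P : Finset G.E} {u v : G.V} (hP : G.IsPath P u v) {l : G.E} {w : G.V}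
    (hl : l ∈ P) (h : G.ends l = Sym2.diag w) : False := by
  have hle := inc_le_degIn hl w
  rw [inc_loop h, if_pos rfl] at hle
  have hu : w ≠ u := by rintro rfl; rw [hP.degIn_left] at hle; omega
  have hv : w ≠ v := by rintro rfl; rw [hP.degIn_right] at hle; omega
  have hw : w ∈ G.support P := mem_support_of_mem hl (by simp [h, Sym2.diag])
  have := hP.connOn.eq_loop hl h (hP.degIn_mid hw hu hv)
  have hu' := hP.left_mem
  rw [this, support_loop h, Finset.mem_singleton] at hu'
  exact hu hu'.symm

theorem IsCircuit.eq_loop {C : Finset G.E} (hC : G.IsCircuit C) {l : G.E} {w : G.V} (hl : l ∈ C)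
    (h : G.ends l = Sym2.diag w) : C = {l} :=
  hC.2.1.eq_loop hl h (hC.2.2 w (mem_support_of_mem hl (by simp [h, Sym2.diag])))

/-- Removing a negative loop from a signed circuit leaves a tadpole. -/
theorem IsSignedCircuit.isTadpole {M : Finset G.E} (hM : G.IsSignedCircuit M) {l : G.E} {w : G.V}
    (hl : l ∈ M) (h : G.negLoop w l) : G.IsTadpole (M.erase l) w := by
  have hsupp := support_loop h.1
  rcases hM with ⟨hC, hb⟩ | ⟨C₁, C₂, hC₁, hC₂, hd, hc, rfl⟩ |
    ⟨C₁, C₂, P, u, v, hC₁, hC₂, hd, hP, hPC₁, hPC₂, hP₁, hP₂, rfl⟩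
  · rw [hC.eq_loop hl h.1, negEdges_singleton h] at hb
    simp at hb
  · have key : ∀ A B : Finset G.E, G.IsUnbalancedCircuit A → G.IsUnbalancedCircuit B →
        Disjoint A B → (G.support A ∩ G.support B).card = 1 → l ∈ A →
        G.IsTadpole ((A ∪ B).erase l) w := by
      intro A B hA hB hd hc hl
      obtain rfl := hA.1.eq_loop hl h.1
      have : ({l} ∪ B).erase l = B := by
        rw [Finset.disjoint_singleton_left] at hd
        ext; simp; grind
      rw [this]
      refine hB.isTadpole ?_
      by_contra hw
      rw [hsupp, Finset.singleton_inter_of_notMem hw] at hc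
      simp at hc
    rcases Finset.mem_union.1 hl with hl | hl
    · exact key _ _ hC₁ hC₂ hd hc hl
    · rw [Finset.union_comm]
      exact key _ _ hC₂ hC₁ hd.symm (by rwa [Finset.inter_comm]) hl
  · have key : ∀ (A B : Finset G.E) (u v : G.V), G.IsUnbalancedCircuit A →
        G.IsUnbalancedCircuit B → Disjoint (G.support A) (G.support B) → G.IsPath P u v →
        G.support P ∩ G.support A = {u} → G.support P ∩ G.support B = {v} → Disjoint P A →
        l ∈ A → G.IsTadpole ((A ∪ B ∪ P).erase l) w := by
      intro A B u v hA hB hd hP hPA hPB hdA hl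
      obtain rfl := hA.1.eq_loop hl h.1
      rw [hsupp] at hPA hd
      obtain rfl : u = w := by simpa using (mem_of_inter_eq hPA).2
      have hlP : l ∉ P := fun hl => hP.not_loop hl h.1
      have hlB : l ∉ B := fun hl => Finset.disjoint_left.1 hd (Finset.mem_singleton_self u)
        (mem_support_of_mem hl (by simp [h.1, Sym2.diag]))
      refine ⟨B, hB, Or.inr ⟨P, v, hP, hPB, ?_⟩⟩
      ext; simp; grind
    rcases Finset.mem_union.1 hl with hl | hl
    · rcases Finset.mem_union.1 hl with hl | hl
      · exact key _ _ u v hC₁ hC₂ hd hP hPC₁ hPC₂ hP₁ hl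
      · rw [Finset.union_comm C₁]
        exact key _ _ v u hC₂ hC₁ hd.symm hP.symm hPC₂ hPC₁ hP₂ hl
    · exact (hP.not_loop hl h.1).elim

/-! ### Covers -/

theorem coverCount_zero (e : G.E) : G.coverCount 0 e = 0 := by simp [coverCount]

theorem coverCount_cons (M : Finset G.E) (F : Multiset (Finset G.E)) (e : G.E) :
    G.coverCount (M ::ₘ F) e = (if e ∈ M then 1 else 0) + G.coverCount F e := by
  unfold coverCount
  split_ifs with h <;> simp [h, add_comm]

theorem coverCount_add (F F' : Multiset (Finset G.E)) (e : G.E) :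
    G.coverCount (F + F') e = G.coverCount F e + G.coverCount F' e := by
  simp [coverCount, Multiset.filter_add]

theorem coverCount_eq_zero {F : Multiset (Finset G.E)} {S : Finset G.E} {e : G.E}
    (h : ∀ M ∈ F, M ⊆ S) (he : e ∉ S) : G.coverCount F e = 0 := by
  rw [coverCount, Multiset.card_eq_zero, Multiset.filter_eq_nil]
  exact fun M hM heM => he (h M hM heM)

theorem exists_mem_of_coverCount {F : Multiset (Finset G.E)} {e : G.E}
    (h : 0 < G.coverCount F e) : ∃ M ∈ F, e ∈ M := by
  obtain ⟨M, hM⟩ := Multiset.card_pos_iff_exists_mem.1 h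
  exact ⟨M, Multiset.mem_filter.1 hM⟩

/-- The subgraph with edge set `S` has a signed circuit double cover. -/
def HasSCDC (G : SignedMultigraph) (S : Finset G.E) : Prop :=
  ∃ F : Multiset (Finset G.E), (∀ M ∈ F, G.IsSignedCircuit M ∧ M ⊆ S) ∧
    ∀ e ∈ S, G.coverCount F e = 2

/-- A double cover of `X` by two tadpoles rooted at `w` and signed circuits. -/
def RootedCover (G : SignedMultigraph) (X : Finset G.E) (w : G.V) : Prop :=
  ∃ (T₁ T₂ : Finset G.E) (F : Multiset (Finset G.E)),
    (G.IsTadpole T₁ w ∧ T₁ ⊆ X) ∧ (G.IsTadpole T₂ w ∧ T₂ ⊆ X) ∧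
    (∀ M ∈ F, G.IsSignedCircuit M ∧ M ⊆ X) ∧
    ∀ e ∈ X, (if e ∈ T₁ then 1 else 0) + (if e ∈ T₂ then 1 else 0) + G.coverCount F e = 2

theorem hasSCDC_empty : G.HasSCDC ∅ := ⟨0, by simp, by simp⟩

theorem IsSignedCircuit.hasSCDC {M : Finset G.E} (h : G.IsSignedCircuit M) : G.HasSCDC M :=
  ⟨M ::ₘ M ::ₘ 0, by simp [h], fun e he => by
    rw [coverCount_cons, coverCount_cons, coverCount_zero, if_pos he]⟩

theorem HasSCDC.union {X Y : Finset G.E} (hX : G.HasSCDC X) (hY : G.HasSCDC Y)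
    (hd : Disjoint X Y) : G.HasSCDC (X ∪ Y) := by
  obtain ⟨F, hF, hF2⟩ := hX
  obtain ⟨F', hF', hF2'⟩ := hY
  refine ⟨F + F', fun M hM => ?_, fun e he => ?_⟩
  · rcases Multiset.mem_add.1 hM with h | h
    · exact ⟨(hF M h).1, (hF M h).2.trans Finset.subset_union_left⟩
    · exact ⟨(hF' M h).1, (hF' M h).2.trans Finset.subset_union_right⟩
  · rw [coverCount_add]
    rcases Finset.mem_union.1 he with h | h
    · rw [hF2 e h, coverCount_eq_zero (fun M hM => (hF' M hM).2) (Finset.disjoint_left.1 hd h)]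
    · rw [hF2' e h, coverCount_eq_zero (fun M hM => (hF M hM).2) (Finset.disjoint_right.1 hd h)]

theorem HasSCDC.rootedCover {X : Finset G.E} {w : G.V} {l : G.E} (h : G.HasSCDC (insert l X))
    (hl : l ∉ X) (hw : G.negLoop w l) : G.RootedCover X w := by
  obtain ⟨F, hF, hF2⟩ := h
  have hsub : ∀ M ⊆ insert l X, M.erase l ⊆ X := fun M hM e he => by
    have := hM (Finset.mem_of_mem_erase he)
    exact (Finset.mem_insert.1 this).resolve_left (Finset.ne_of_mem_erase he)
  have hl2 := hF2 l (Finset.mem_insert_self _ _)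
  obtain ⟨M₁, hM₁, hlM₁⟩ := exists_mem_of_coverCount (by omega : 0 < G.coverCount F l)
  obtain ⟨F₁, rfl⟩ := Multiset.exists_cons_of_mem hM₁
  rw [coverCount_cons, if_pos hlM₁] at hl2
  obtain ⟨M₂, hM₂, hlM₂⟩ := exists_mem_of_coverCount (by omega : 0 < G.coverCount F₁ l)
  obtain ⟨F₂, rfl⟩ := Multiset.exists_cons_of_mem hM₂
  rw [coverCount_cons, if_pos hlM₂] at hl2
  have h1 := hF M₁ (by simp)
  have h2 := hF M₂ (by simp)
  refine ⟨M₁.erase l, M₂.erase l, F₂, ⟨h1.1.isTadpole hlM₁ hw, hsub _ h1.2⟩,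
    ⟨h2.1.isTadpole hlM₂ hw, hsub _ h2.2⟩, fun M hM => ?_, fun e he => ?_⟩
  · have h := hF M (by simp [hM])
    refine ⟨h.1, fun e he => (Finset.mem_insert.1 (h.2 he)).resolve_left ?_⟩
    rintro rfl
    have : 0 < G.coverCount F₂ e := by
      rw [coverCount, Multiset.card_pos_iff_exists_mem]
      exact ⟨M, Multiset.mem_filter.2 ⟨hM, he⟩⟩
    omega
  · have h := hF2 e (Finset.mem_insert_of_mem he)
    have hne : e ≠ l := fun h => hl (h ▸ he)
    rw [coverCount_cons, coverCount_cons, ← add_assoc] at h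
    simpa [Finset.mem_erase, hne] using h

theorem RootedCover.extend {X : Finset G.E} {x y : G.V} {e : G.E} (h : G.RootedCover X x)
    (he : G.ends e = s(y, x)) (hy : y ∉ G.support X) : G.RootedCover (insert e X) y := by
  obtain ⟨T₁, T₂, F, ⟨h1, h1X⟩, ⟨h2, h2X⟩, hF, hF2⟩ := h
  have hyx : y ≠ x := by
    rintro rfl
    exact hy (support_mono h1X h1.root_mem)
  have heX : e ∉ X := fun h => hy (mem_support_of_mem h (by simp [he]))
  have key : ∀ T ⊆ X, G.IsTadpole T x → G.IsTadpole (T ∪ {e}) y := by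
    intro T hTX hT
    refine hT.extend (isPath_singleton he hyx) ?_
    ext v
    simp only [Finset.mem_inter, mem_support_singleton, he, Sym2.mem_iff, Finset.mem_singleton]
    constructor
    · rintro ⟨rfl | rfl, h⟩
      · exact absurd (support_mono hTX h) hy
      · rfl
    · rintro rfl
      exact ⟨Or.inr rfl, hT.root_mem⟩
  have hsub : ∀ T ⊆ X, T ∪ {e} ⊆ insert e X := fun T hT => by
    rw [Finset.insert_eq, Finset.union_comm]
    exact Finset.union_subset_union_right hT
  refine ⟨T₁ ∪ {e}, T₂ ∪ {e}, F, ⟨key _ h1X h1, hsub _ h1X⟩, ⟨key _ h2X h2, hsub _ h2X⟩,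
    fun M hM => ⟨(hF M hM).1, (hF M hM).2.trans (Finset.subset_insert _ _)⟩, fun f hf => ?_⟩
  rcases Finset.mem_insert.1 hf with rfl | hf
  · rw [coverCount_eq_zero (fun M hM => (hF M hM).2) heX]
    simp
  · have hne : f ≠ e := fun h => heX (h ▸ hf)
    simpa [hne] using hF2 f hf

theorem RootedCover.glue {X Y : Finset G.E} {w : G.V} (hX : G.RootedCover X w)
    (hY : G.RootedCover Y w) (hd : Disjoint X Y)
    (h : ∀ v ∈ G.support X, v ∈ G.support Y → v = w) : G.HasSCDC (X ∪ Y) := by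
  obtain ⟨T₁, T₂, F, ⟨h1, h1X⟩, ⟨h2, h2X⟩, hF, hF2⟩ := hX
  obtain ⟨T₁', T₂', F', ⟨h1', h1Y⟩, ⟨h2', h2Y⟩, hF', hF2'⟩ := hY
  have key : ∀ T ⊆ X, ∀ T' ⊆ Y, G.IsTadpole T w → G.IsTadpole T' w →
      G.IsSignedCircuit (T ∪ T') ∧ T ∪ T' ⊆ X ∪ Y := by
    intro T hTX T' hTY hT hT'
    refine ⟨hT.glue hT' (hd.mono hTX hTY) ?_, Finset.union_subset_union hTX hTY⟩
    ext v
    simp only [Finset.mem_inter, Finset.mem_singleton]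
    refine ⟨fun hv => h v (support_mono hTX hv.1) (support_mono hTY hv.2), ?_⟩
    rintro rfl
    exact ⟨hT.root_mem, hT'.root_mem⟩
  refine ⟨(T₁ ∪ T₁') ::ₘ (T₂ ∪ T₂') ::ₘ (F + F'), fun M hM => ?_, fun e he => ?_⟩
  · simp only [Multiset.mem_cons, Multiset.mem_add] at hM
    rcases hM with rfl | rfl | hM | hM
    · exact key _ h1X _ h1Y h1 h1'
    · exact key _ h2X _ h2Y h2 h2'
    · exact ⟨(hF M hM).1, (hF M hM).2.trans Finset.subset_union_left⟩
    · exact ⟨(hF' M hM).1, (hF' M hM).2.trans Finset.subset_union_right⟩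
  · rw [coverCount_cons, coverCount_cons, coverCount_add, ← add_assoc]
    rcases Finset.mem_union.1 he with he | he
    · have heY := Finset.disjoint_left.1 hd he
      rw [coverCount_eq_zero (fun M hM => (hF' M hM).2) heY]
      have a1 : e ∉ T₁' := fun h => heY (h1Y h)
      have a2 : e ∉ T₂' := fun h => heY (h2Y h)
      simpa [a1, a2] using hF2 e he
    · have heX := Finset.disjoint_right.1 hd he
      rw [coverCount_eq_zero (fun M hM => (hF M hM).2) heX]
      have a1 : e ∉ T₁ := fun h => heX (h1X h)
      have a2 : e ∉ T₂ := fun h => heX (h2X h)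
      simpa [a1, a2] using hF2' e he

/-! ### Circuits with negative loops attached -/

theorem card_negEdges_union {S T : Finset G.E} (h : Disjoint S T) :
    (G.negEdges (S ∪ T)).card = (G.negEdges S).card + (G.negEdges T).card := by
  rw [negEdges, Finset.filter_union, Finset.card_union_of_disjoint]
  · rfl
  · exact Finset.disjoint_filter_filter h

/-- A path in `D` together with negative loops from `L` at its two ends. -/
def IsLoopPath (G : SignedMultigraph) (D L M : Finset G.E) : Prop :=
  ∃ (l l' : G.E) (P : Finset G.E) (u v : G.V), l ∈ L ∧ l' ∈ L ∧ G.negLoop u l ∧ G.negLoop v l' ∧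
    P ⊆ D ∧ G.IsPath P u v ∧ M = {l, l'} ∪ P

theorem IsLoopPath.subset {D L M : Finset G.E} (h : G.IsLoopPath D L M) : M ⊆ D ∪ L := by
  obtain ⟨l, l', P, u, v, hl, hl', -, -, hP, -, rfl⟩ := h
  intro e he
  simp only [Finset.mem_union, Finset.mem_insert, Finset.mem_singleton] at he ⊢
  rcases he with (rfl | rfl) | he
  · exact Or.inr hl
  · exact Or.inr hl'
  · exact Or.inl (hP he)

theorem IsLoopPath.mono {D L L' M : Finset G.E} (h : G.IsLoopPath D L M) (hL : L ⊆ L') :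
    G.IsLoopPath D L' M := by
  obtain ⟨l, l', P, u, v, hl, hl', h⟩ := h
  exact ⟨l, l', P, u, v, hL hl, hL hl', h⟩

theorem IsLoopPath.isSignedCircuit {D L M : Finset G.E} (h : G.IsLoopPath D L M) :
    G.IsSignedCircuit M := by
  obtain ⟨l, l', P, u, v, -, -, hl, hl', -, hP, rfl⟩ := h
  have hT : G.IsTadpole ({l} ∪ P) v := (isTadpole_loop hl).extend hP.symm (by
    rw [support_loop hl.1]
    exact Finset.inter_singleton_of_mem hP.left_mem)
  have hll : l ≠ l' := by
    rintro rfl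
    exact hP.ne (Sym2.diag_injective (hl.1.symm.trans hl'.1))
  have := hT.glue (isTadpole_loop hl') (by
    rw [Finset.disjoint_singleton_right, Finset.mem_union, Finset.mem_singleton]
    exact fun h => h.elim (fun h => hll h.symm) fun h => hP.not_loop h hl'.1) (by
    rw [support_loop hl'.1]
    exact Finset.inter_singleton_of_mem hT.root_mem)
  convert this using 1
  ext e
  simp only [Finset.mem_union, Finset.mem_insert, Finset.mem_singleton]
  tauto

/-- A double cover of `D ∪ L` by loop paths. -/
def LoopPathCover (G : SignedMultigraph) (D L : Finset G.E) : Prop :=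
  ∃ F : Multiset (Finset G.E), (∀ M ∈ F, G.IsLoopPath D L M) ∧
    ∀ e ∈ D ∪ L, G.coverCount F e = 2

theorem LoopPathCover.hasSCDC {D L : Finset G.E} (h : G.LoopPathCover D L) :
    G.HasSCDC (D ∪ L) := by
  obtain ⟨F, hF, hF2⟩ := h
  exact ⟨F, fun M hM => ⟨(hF M hM).isSignedCircuit, (hF M hM).subset⟩, hF2⟩

theorem IsPath.loop_notMem {P : Finset G.E} {u v w : G.V} {l : G.E} (hP : G.IsPath P u v)
    (hl : G.negLoop w l) : l ∉ P := fun h => hP.not_loop h hl.1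

theorem loopPathCover_three_of_mem {D A : Finset G.E} {z₁ z₂ z₃ : G.V} {l₁ l₂ l₃ : G.E}
    (h₁ : G.negLoop z₁ l₁) (h₂ : G.negLoop z₂ l₂) (h₃ : G.negLoop z₃ l₃)
    (h13 : z₃ ≠ z₁) (h23 : z₃ ≠ z₂) (hAD : A ⊆ D) (hA : G.IsPath A z₁ z₂)
    (hB : G.IsPath (D \ A) z₁ z₂)
    (hAB : ∀ w, w ∈ G.support A → w ∈ G.support (D \ A) → w = z₁ ∨ w = z₂)
    (hz : z₃ ∈ G.support A) : G.LoopPathCover D {l₁, l₂, l₃} := by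
  obtain ⟨A₁, hA₁A, hA₁, hA₂, h12⟩ := hA.split hz h13 h23
  have hAsub : G.support (A \ A₁) ⊆ G.support A := support_mono Finset.sdiff_subset
  obtain ⟨-, hQ⟩ := hA₂.concat hB.symm (by
    ext w
    simp only [Finset.mem_inter, Finset.mem_singleton]
    constructor
    · rintro ⟨hw, hw'⟩
      refine (hAB w (hAsub hw) hw').resolve_left ?_
      rintro rfl
      exact h13 (eq_of_inter_eq h12 hA₁.left_mem hw).symm
    · rintro rfl
      exact ⟨hA₂.right_mem, hB.right_mem⟩)
  obtain ⟨-, hR⟩ := hB.symm.concat hA₁ (by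
    ext w
    simp only [Finset.mem_inter, Finset.mem_singleton]
    constructor
    · rintro ⟨hw, hw'⟩
      refine (hAB w (support_mono hA₁A hw') hw).resolve_right ?_
      rintro rfl
      exact h23 (eq_of_inter_eq h12 hw' hA₂.right_mem).symm
    · rintro rfl
      exact ⟨hB.left_mem, hA₁.left_mem⟩)
  refine ⟨({l₁, l₂} ∪ A) ::ₘ ({l₃, l₁} ∪ (A \ A₁ ∪ D \ A)) ::ₘ ({l₂, l₃} ∪ (D \ A ∪ A₁)) ::ₘ 0,
    fun M hM => ?_, fun e he => ?_⟩
  · simp only [Multiset.mem_cons, Multiset.notMem_zero, or_false] at hM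
    rcases hM with rfl | rfl | rfl
    · exact ⟨l₁, l₂, A, z₁, z₂, by simp, by simp, h₁, h₂, hAD, hA, rfl⟩
    · exact ⟨l₃, l₁, _, z₃, z₁, by simp, by simp, h₃, h₁, Finset.union_subset
        (Finset.sdiff_subset.trans hAD) Finset.sdiff_subset, hQ, rfl⟩
    · exact ⟨l₂, l₃, _, z₂, z₃, by simp, by simp, h₂, h₃, Finset.union_subset
        Finset.sdiff_subset (hA₁A.trans hAD), hR, rfl⟩
  · have hne : ∀ {u v : G.V} {l l' : G.E}, G.negLoop u l → G.negLoop v l' → u ≠ v → l ≠ l' := by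
      rintro u v l _ hl hl' huv rfl
      exact huv (Sym2.diag_injective (hl.1.symm.trans hl'.1))
    have n12 := hne h₁ h₂ hA.ne
    have n31 := hne h₃ h₁ h13
    have n32 := hne h₃ h₂ h23
    have hD : ∀ {w : G.V} {l : G.E}, G.negLoop w l → l ∉ D := by
      intro w l hl hlD
      by_cases h : l ∈ A
      · exact hA.not_loop h hl.1
      · exact hB.not_loop (Finset.mem_sdiff.2 ⟨hlD, h⟩) hl.1
    have a1 := hD h₁
    have a2 := hD h₂
    have a3 := hD h₃
    simp only [coverCount_cons, coverCount_zero, Finset.mem_union, Finset.mem_insert,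
      Finset.mem_singleton, Finset.mem_sdiff] at he ⊢
    have i1 := @hAD e
    have i2 := @hA₁A e
    rcases he with he | rfl | rfl | rfl
    · have b1 : e ≠ l₁ := by rintro rfl; exact a1 he
      have b2 : e ≠ l₂ := by rintro rfl; exact a2 he
      have b3 : e ≠ l₃ := by rintro rfl; exact a3 he
      by_cases c1 : e ∈ A <;> by_cases c2 : e ∈ A₁ <;> simp_all
    · have := mt i1 a1
      have := mt i2 this
      simp_all [Ne.symm]
    · have := mt i1 a2
      have := mt i2 this
      simp_all [Ne.symm]
    · have := mt i1 a3
      have := mt i2 this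
      simp_all [Ne.symm]

theorem loopPathCover_three {D : Finset G.E} (hD : G.IsCircuit D) {z₁ z₂ z₃ : G.V} {l₁ l₂ l₃ : G.E}
    (h₁ : G.negLoop z₁ l₁) (h₂ : G.negLoop z₂ l₂) (h₃ : G.negLoop z₃ l₃)
    (h12 : z₁ ≠ z₂) (h13 : z₃ ≠ z₁) (h23 : z₃ ≠ z₂) (m₁ : z₁ ∈ G.support D)
    (m₂ : z₂ ∈ G.support D) (m₃ : z₃ ∈ G.support D) : G.LoopPathCover D {l₁, l₂, l₃} := by
  obtain ⟨A, hAD, hA, hB, hAB⟩ := hD.split m₁ m₂ h12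
  have : D = A ∪ D \ A := (Finset.union_sdiff_of_subset hAD).symm
  rw [this, support_union, Finset.mem_union] at m₃
  rcases m₃ with m₃ | m₃
  · exact loopPathCover_three_of_mem h₁ h₂ h₃ h13 h23 hAD hA hB hAB m₃
  · have hBB : D \ (D \ A) = A := Finset.sdiff_sdiff_eq_self hAD
    exact loopPathCover_three_of_mem h₁ h₂ h₃ h13 h23 Finset.sdiff_subset hB (by rwa [hBB])
      (fun w hw hw' => hAB w (by rwa [hBB] at hw') hw) m₃

theorem LoopPathCover.insert_loop {D L : Finset G.E} (h : G.LoopPathCover D L) {z : G.V} {l : G.E}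
    (hl : G.negLoop z l) (hlD : l ∉ D) (hz : z ∈ G.support D)
    (hL : ∀ l' ∈ L, ¬ G.negLoop z l') : G.LoopPathCover D (insert l L) := by
  have hlL : l ∉ L := fun h => hL l h hl
  obtain ⟨F, hF, hF2⟩ := h
  obtain ⟨e, heD, hze⟩ := mem_support.1 hz
  obtain ⟨M, hM, heM⟩ := exists_mem_of_coverCount
    (by rw [hF2 e (Finset.mem_union_left _ heD)]; norm_num : 0 < G.coverCount F e)
  obtain ⟨F, rfl⟩ := Multiset.exists_cons_of_mem hM
  obtain ⟨l₁, l₂, P, u, v, hl₁, hl₂, hu, hv, hPD, hP, rfl⟩ := hF M (by simp)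
  have hzu : z ≠ u := by rintro rfl; exact hL _ hl₁ hu
  have hzv : z ≠ v := by rintro rfl; exact hL _ hl₂ hv
  have heP : e ∈ P := by
    simp only [Finset.mem_union, Finset.mem_insert, Finset.mem_singleton] at heM
    rcases heM with (rfl | rfl) | h
    · rw [hu.1] at hze
      exact absurd (by simpa [Sym2.diag] using hze) hzu
    · rw [hv.1] at hze
      exact absurd (by simpa [Sym2.diag] using hze) hzv
    · exact h
  obtain ⟨A, hAP, hA, hB, -⟩ := hP.split (mem_support_of_mem heP hze) hzu hzv
  refine ⟨({l₁, l} ∪ A) ::ₘ ({l, l₂} ∪ (P \ A)) ::ₘ F, fun M hM => ?_, fun f hf => ?_⟩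
  · simp only [Multiset.mem_cons] at hM
    rcases hM with rfl | rfl | hM
    · exact ⟨l₁, l, A, u, z, by simp [hl₁], by simp, hu, hl, hAP.trans hPD, hA, rfl⟩
    · exact ⟨l, l₂, _, z, v, by simp, by simp [hl₂], hl, hv, Finset.sdiff_subset.trans hPD, hB, rfl⟩
    · exact (hF M (by simp [hM])).mono (Finset.subset_insert _ _)
  · have hlP : l ∉ P := fun h => hlD (hPD h)
    have hlA : l ∉ A := fun h => hlP (hAP h)
    have n1 : l ≠ l₁ := by rintro rfl; exact hlL hl₁
    have n2 : l ≠ l₂ := by rintro rfl; exact hlL hl₂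
    have n12 : l₁ ≠ l₂ := by
      rintro rfl
      exact hP.ne (Sym2.diag_injective (hu.1.symm.trans hv.1))
    have p1 := hP.loop_notMem hu
    have p2 := hP.loop_notMem hv
    have q1 := hA.loop_notMem hu
    have q2 := hA.loop_notMem hv
    by_cases hfl : f = l
    · subst hfl
      have hF0 : G.coverCount F f = 0 :=
        coverCount_eq_zero (fun M hM => (hF M (by simp [hM])).subset)
          (by simp [hlD, hlL])
      simp [coverCount_cons, hF0]
    · have hf' : f ∈ D ∪ L := by
        simp only [Finset.mem_union, Finset.mem_insert] at hf ⊢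
        tauto
      have := hF2 f hf'
      have i := @hAP f
      simp only [coverCount_cons, Finset.mem_union, Finset.mem_insert,
        Finset.mem_singleton, Finset.mem_sdiff] at this ⊢
      rw [← this]
      by_cases c1 : f = l₁
      · subst c1; simp_all
      · by_cases c2 : f = l₂
        · subst c2; simp_all
        · by_cases c3 : f ∈ P <;> by_cases c4 : f ∈ A <;> simp_all

theorem loopPathCover_of_three_le {D : Finset G.E} (hD : G.IsCircuit D) :
    ∀ (n : ℕ) (L : Finset G.E), L.card = n + 3 → Disjoint D L →
      (∀ l ∈ L, ∃ w ∈ G.support D, G.negLoop w l) →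
      (∀ l ∈ L, ∀ l' ∈ L, ∀ w, G.negLoop w l → G.negLoop w l' → l = l') →
      G.LoopPathCover D L := by
  intro n
  induction n with
  | zero =>
    intro L hc hd hL hinj
    obtain ⟨l₁, l₂, l₃, n12, n13, n23, rfl⟩ := Finset.card_eq_three.1 hc
    obtain ⟨z₁, m₁, h₁⟩ := hL l₁ (by simp)
    obtain ⟨z₂, m₂, h₂⟩ := hL l₂ (by simp)
    obtain ⟨z₃, m₃, h₃⟩ := hL l₃ (by simp)
    refine loopPathCover_three hD h₁ h₂ h₃ ?_ ?_ ?_ m₁ m₂ m₃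
    · rintro rfl; exact n12 (hinj _ (by simp) _ (by simp) _ h₁ h₂)
    · rintro rfl; exact n13 (hinj _ (by simp) _ (by simp) _ h₁ h₃)
    · rintro rfl; exact n23 (hinj _ (by simp) _ (by simp) _ h₂ h₃)
  | succ n ih =>
    intro L hc hd hL hinj
    obtain ⟨l, hl⟩ : L.Nonempty := Finset.card_pos.1 (by omega)
    obtain ⟨z, hz, hlz⟩ := hL l hl
    have hsub := Finset.erase_subset l L
    have := ih (L.erase l) (by rw [Finset.card_erase_of_mem hl]; omega)
      (hd.mono_right hsub) (fun l' h => hL l' (hsub h))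
      (fun l' h l'' h' => hinj l' (hsub h) l'' (hsub h'))
    have := this.insert_loop hlz (Finset.disjoint_right.1 hd hl) hz fun l' hl' h' =>
      Finset.ne_of_mem_erase hl' (hinj l' (hsub hl') l hl z h' hlz)
    rwa [Finset.insert_erase hl] at this

theorem IsCircuit.hasSCDC_union {D L : Finset G.E} (hD : G.IsCircuit D) (hd : Disjoint D L)
    (hL : ∀ l ∈ L, ∃ w ∈ G.support D, G.negLoop w l)
    (hinj : ∀ l ∈ L, ∀ l' ∈ L, ∀ w, G.negLoop w l → G.negLoop w l' → l = l')
    (hev : Even (G.negEdges (D ∪ L)).card) : G.HasSCDC (D ∪ L) := by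
  rw [card_negEdges_union hd] at hev
  have hLneg : G.negEdges L = L := Finset.filter_true_of_mem fun l hl => by
    obtain ⟨w, -, hw⟩ := hL l hl
    exact hw.2
  rw [hLneg] at hev
  obtain h | h | h | h : L.card = 0 ∨ L.card = 1 ∨ L.card = 2 ∨ ∃ n, L.card = n + 3 := by
    rcases lt_or_ge L.card 3 with h | h
    · omega
    · exact Or.inr (Or.inr (Or.inr ⟨L.card - 3, by omega⟩))
  · rw [Finset.card_eq_zero] at h
    subst h
    rw [Finset.union_empty]
    exact IsSignedCircuit.hasSCDC (Or.inl ⟨hD, by simpa using hev⟩)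
  · obtain ⟨l, rfl⟩ := Finset.card_eq_one.1 h
    obtain ⟨w, hw, hl⟩ := hL l (by simp)
    have hDu : G.IsUnbalancedCircuit D := ⟨hD, fun he => by
      rw [Finset.card_singleton] at hev
      rw [Nat.even_add_one] at hev
      exact hev he⟩
    exact (IsTadpole.glue (hDu.isTadpole hw) (isTadpole_loop hl) hd (by
      rw [support_loop hl.1]
      exact Finset.inter_singleton_of_mem hw)).hasSCDC
  · obtain ⟨l₁, l₂, n12, rfl⟩ := Finset.card_eq_two.1 h
    obtain ⟨z₁, m₁, h₁⟩ := hL l₁ (by simp)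
    obtain ⟨z₂, m₂, h₂⟩ := hL l₂ (by simp)
    have hz : z₁ ≠ z₂ := by rintro rfl; exact n12 (hinj _ (by simp) _ (by simp) _ h₁ h₂)
    obtain ⟨A, hAD, hA, hB, hAB⟩ := hD.split m₁ m₂ hz
    have hDb : G.IsBalancedCircuit D := ⟨hD, by
      rw [h] at hev
      exact (Nat.even_add.1 hev).2 even_two⟩
    refine ⟨({l₁, l₂} ∪ A) ::ₘ ({l₁, l₂} ∪ (D \ A)) ::ₘ D ::ₘ 0, fun M hM => ?_, fun e he => ?_⟩
    · have key : ∀ M, G.IsLoopPath D {l₁, l₂} M → G.IsSignedCircuit M ∧ M ⊆ D ∪ {l₁, l₂} :=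
        fun M hM => ⟨hM.isSignedCircuit, hM.subset⟩
      simp only [Multiset.mem_cons, Multiset.notMem_zero, or_false] at hM
      rcases hM with rfl | rfl | rfl
      · exact key _ ⟨l₁, l₂, _, z₁, z₂, by simp, by simp, h₁, h₂, hAD, hA, rfl⟩
      · exact key _ ⟨l₁, l₂, _, z₁, z₂, by simp, by simp, h₁, h₂, Finset.sdiff_subset, hB, rfl⟩
      · exact ⟨Or.inl hDb, Finset.subset_union_left⟩
    · have i := @hAD e
      by_cases heD : e ∈ D
      · have n1 : e ∉ ({l₁, l₂} : Finset G.E) := Finset.disjoint_left.1 hd heD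
        simp only [coverCount_cons, coverCount_zero, Finset.mem_union, n1, false_or,
          Finset.mem_sdiff, heD]
        by_cases c : e ∈ A <;> simp [c]
      · have n1 := (Finset.mem_union.1 he).resolve_left heD
        simp only [coverCount_cons, coverCount_zero, Finset.mem_union, n1, true_or, heD]
        simp
  · obtain ⟨n, h⟩ := h
    exact (loopPathCover_of_three_le hD n L h hd hL hinj).hasSCDC

/-! ### Eulerian subgraphs with an even number of negative edges -/

theorem card_negEdges_sdiff_add {S A : Finset G.E} (h : A ⊆ S) :
    (G.negEdges (S \ A)).card + (G.negEdges A).card = (G.negEdges S).card := by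
  rw [← card_negEdges_union Finset.sdiff_disjoint, Finset.sdiff_union_of_subset h]

/-- The negative loops at `w` outside `S`. -/
def freeLoops (G : SignedMultigraph) (S : Finset G.E) (w : G.V) : Finset G.E :=
  (Finset.univ.filter fun l => G.negLoop w l) \ S

theorem mem_freeLoops {S : Finset G.E} {w : G.V} {l : G.E} :
    l ∈ G.freeLoops S w ↔ G.negLoop w l ∧ l ∉ S := by simp [freeLoops]

theorem card_freeLoops_anti {S T : Finset G.E} (h : S ⊆ T) (w : G.V) :
    (G.freeLoops T w).card ≤ (G.freeLoops S w).card :=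
  Finset.card_le_card (Finset.sdiff_subset_sdiff subset_rfl h)

theorem card_freeLoops_insert {S : Finset G.E} (l : G.E) (w : G.V) :
    (G.freeLoops S w).card ≤ (G.freeLoops (insert l S) w).card + 1 := by
  have : G.freeLoops S w ⊆ insert l (G.freeLoops (insert l S) w) := by
    intro e he
    simp only [Finset.mem_insert, mem_freeLoops] at he ⊢
    tauto
  exact (Finset.card_le_card this).trans (Finset.card_insert_le _ _)

/-- A connected edge set all of whose degrees are even. -/
structure IsEuler (G : SignedMultigraph) (S : Finset G.E) : Prop where
  connOn : G.ConnOn S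
  even : ∀ v, Even (G.degIn S v)

theorem even_inc_loop {l : G.E} {w : G.V} (h : G.ends l = Sym2.diag w) (v : G.V) :
    Even (G.inc l v) := by
  rw [inc_loop h]
  split_ifs <;> simp

theorem IsEuler.insert_loop {S : Finset G.E} {w : G.V} {l : G.E} (hS : G.IsEuler S)
    (hw : w ∈ G.support S) (h : G.ends l = Sym2.diag w) (hl : l ∉ S) : G.IsEuler (insert l S) where
  connOn := by
    rw [Finset.insert_eq]
    exact (connOn_singleton l).union hS.connOn (by simp [support_loop h]) hw
  even v := by
    rw [Finset.insert_eq, degIn_union (by simpa using hl), degIn_singleton]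
    exact (even_inc_loop h v).add (hS.even v)

theorem card_negEdges_insert_loop {S : Finset G.E} {w : G.V} {l : G.E} (h : G.negLoop w l)
    (hl : l ∉ S) : (G.negEdges (insert l S)).card = (G.negEdges S).card + 1 := by
  rw [Finset.insert_eq, card_negEdges_union (by simpa using hl), negEdges_singleton h, add_comm,
    Finset.card_singleton]

/-- `Y` and `S \ Y` partition `S` into two nonempty connected even subgraphs. -/
structure EulerSplit (G : SignedMultigraph) (S Y : Finset G.E) : Prop where
  subset : Y ⊆ S
  nonempty : Y.Nonempty
  nonempty' : (S \ Y).Nonempty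
  left : G.IsEuler Y
  right : G.IsEuler (S \ Y)

theorem EulerSplit.symm {S Y : Finset G.E} (h : G.EulerSplit S Y) : G.EulerSplit S (S \ Y) := by
  have : S \ (S \ Y) = Y := Finset.sdiff_sdiff_eq_self h.subset
  exact ⟨Finset.sdiff_subset, h.nonempty', this.symm ▸ h.nonempty, h.right, this.symm ▸ h.left⟩

theorem even_degIn_sdiff {S A : Finset G.E} (h : A ⊆ S) {v : G.V} (hS : Even (G.degIn S v))
    (hA : Even (G.degIn A v)) : Even (G.degIn (S \ A) v) := by
  rw [← degIn_sdiff_add h, Nat.even_add] at hS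
  exact hS.2 hA

theorem odd_degIn_sdiff {S A : Finset G.E} (h : A ⊆ S) {v : G.V} (hS : Even (G.degIn S v))
    (hA : Odd (G.degIn A v)) : Odd (G.degIn (S \ A) v) := by
  rw [← degIn_sdiff_add h, Nat.even_add'] at hS
  exact hS.2 hA

theorem IsEuler.union_of_odd {A B : Finset G.E} {x y : G.V} (hd : Disjoint A B)
    (hA : G.ConnOn A) (hB : G.ConnOn B) (hAx : Odd (G.degIn A x)) (hAy : Odd (G.degIn A y))
    (hAe : ∀ v, v ≠ x → v ≠ y → Even (G.degIn A v)) (hBx : Odd (G.degIn B x))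
    (hBy : Odd (G.degIn B y)) (hBe : ∀ v, v ≠ x → v ≠ y → Even (G.degIn B v)) :
    G.IsEuler (A ∪ B) where
  connOn := hA.union hB (mem_support_of_odd hAx) (mem_support_of_odd hBx)
  even v := by
    rw [degIn_union hd]
    by_cases hx : v = x
    · subst hx; exact hAx.add_odd hBx
    · by_cases hy : v = y
      · subst hy; exact hAy.add_odd hBy
      · exact (hAe v hx hy).add (hBe v hx hy)

theorem EulerSplit.inter_eq {S Y : Finset G.E} (hS : G.IsEuler S)
    (hirr : ∀ Y, G.EulerSplit S Y → Odd (G.negEdges Y).card) (hY : G.EulerSplit S Y) :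
    ∃ w, G.support Y ∩ G.support (S \ Y) = {w} := by
  obtain ⟨w, hw, hw'⟩ := hS.connOn.exists_common hY.subset hY.nonempty hY.nonempty'
  refine ⟨w, Finset.eq_singleton_iff_unique_mem.2 ⟨Finset.mem_inter.2 ⟨hw, hw'⟩, fun x hx => ?_⟩⟩
  obtain ⟨hx, hx'⟩ := Finset.mem_inter.1 hx
  by_contra hne
  obtain ⟨A, hAY, hA, hA', hAx, hAw, hAe⟩ := exists_split hY.left.connOn hY.left.even hx hw hne
  have key : ∀ B ⊆ S \ Y, G.ConnOn B → G.ConnOn ((S \ Y) \ B) → Odd (G.degIn B x) →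
      Odd (G.degIn B w) → (∀ v, v ≠ x → v ≠ w → Even (G.degIn B v)) →
      Odd ((G.negEdges A).card + (G.negEdges B).card) := by
    intro B hBZ hB hB' hBx hBw hBe
    have hd : Disjoint A B := Finset.disjoint_sdiff.mono hAY hBZ
    rw [← card_negEdges_union hd]
    have hc : S \ (A ∪ B) = (Y \ A) ∪ ((S \ Y) \ B) := by
      ext e
      have i1 := @hAY e
      have i2 := @hBZ e
      have i3 := @hY.subset e
      simp only [Finset.mem_sdiff, Finset.mem_union] at i2 ⊢
      tauto
    have hodd := @odd_degIn_sdiff G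
    have hR : G.IsEuler (S \ (A ∪ B)) := by
      rw [hc]
      refine IsEuler.union_of_odd
        (Finset.disjoint_sdiff.mono Finset.sdiff_subset Finset.sdiff_subset) hA' hB'
        (hodd hAY (hY.left.even x) hAx) (hodd hAY (hY.left.even w) hAw)
        (fun v h1 h2 => even_degIn_sdiff hAY (hY.left.even v) (hAe v h1 h2))
        (hodd hBZ (hY.right.even x) hBx) (hodd hBZ (hY.right.even w) hBw)
        (fun v h1 h2 => even_degIn_sdiff hBZ (hY.right.even v) (hBe v h1 h2))
    refine hirr _ ⟨Finset.union_subset (hAY.trans hY.subset) (hBZ.trans Finset.sdiff_subset), ?_, ?_,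
      IsEuler.union_of_odd hd hA hB hAx hAw hAe hBx hBw hBe, hR⟩
    · obtain ⟨e, he, -⟩ := mem_support.1 (mem_support_of_odd hAx)
      exact ⟨e, Finset.mem_union_left _ he⟩
    · obtain ⟨e, he, -⟩ := mem_support.1 (mem_support_of_odd (hodd hAY (hY.left.even x) hAx))
      rw [hc]
      exact ⟨e, Finset.mem_union_left _ he⟩
  obtain ⟨B, hBZ, hB, hB', hBx, hBw, hBe⟩ := exists_split hY.right.connOn hY.right.even hx' hw' hne
  have h1 := key B hBZ hB hB' hBx hBw hBe
  have h2 := key ((S \ Y) \ B) Finset.sdiff_subset hB'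
    (by rwa [Finset.sdiff_sdiff_eq_self hBZ]) (odd_degIn_sdiff hBZ (hY.right.even x) hBx)
    (odd_degIn_sdiff hBZ (hY.right.even w) hBw)
    (fun v h1 h2 => even_degIn_sdiff hBZ (hY.right.even v) (hBe v h1 h2))
  have h3 := hirr _ hY.symm
  have h4 := card_negEdges_sdiff_add hBZ
  rw [← h4] at h3
  simp only [Nat.odd_iff] at h1 h2 h3
  omega

theorem exists_ends_of_not_loop {e : G.E} (h : ∀ w, G.ends e ≠ Sym2.diag w) :
    ∃ x y, x ≠ y ∧ G.ends e = s(x, y) := by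
  obtain ⟨x, y, hxy⟩ : ∃ x y, G.ends e = s(x, y) :=
    Sym2.inductionOn (G.ends e) fun x y => ⟨x, y, rfl⟩
  refine ⟨x, y, ?_, hxy⟩
  rintro rfl
  exact h x hxy

theorem exists_loop_of_even {e : G.E} (h : ∀ v, Even (G.inc e v)) :
    ∃ w, G.ends e = Sym2.diag w := by
  by_contra! hne
  obtain ⟨x, y, hxy, he⟩ := exists_ends_of_not_loop hne
  have := h x
  rw [inc_link he hxy] at this
  simp at this

/-- If every split of `S` into two even connected parts has a part with a single edge, and all
parts have odd sign, then the edges outside a long circuit are negative loops at its vertices. -/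
theorem loop_of_notMem_circuit {S D : Finset G.E} (hS : G.IsEuler S)
    (hirr : ∀ Y, G.EulerSplit S Y → Odd (G.negEdges Y).card)
    (hone : ∀ Y, G.EulerSplit S Y → Y.card = 1 ∨ (S \ Y).card = 1) (hDS : D ⊆ S)
    (hD : G.IsCircuit D) (hD2 : 2 ≤ D.card) {f : G.E} (hf : f ∈ S \ D) :
    ∃ w ∈ G.support D, G.negLoop w f ∧ ∀ g ∈ S \ D, w ∈ G.ends g → g = f := by
  obtain ⟨x, hx⟩ : ∃ x, x ∈ G.ends f := ⟨_, Sym2.out_fst_mem _⟩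
  have hKsub := compEdges_subset (S \ D) x
  have hfK : f ∈ G.compEdges (S \ D) x := mem_compEdges_of_mem hf hx .refl
  have hDK : D ⊆ S \ G.compEdges (S \ D) x := fun e he => Finset.mem_sdiff.2
    ⟨hDS he, fun h => (Finset.mem_sdiff.1 (hKsub h)).2 he⟩
  have hKS := hKsub.trans Finset.sdiff_subset
  have hKe : ∀ v, Even (G.degIn (G.compEdges (S \ D) x) v) := fun v =>
    even_degIn_compEdges (even_degIn_sdiff hDS (hS.even v) (hD.even_degIn v))
  have hK : G.EulerSplit S (G.compEdges (S \ D) x) :=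
    ⟨hKS, ⟨f, hfK⟩, hD.1.mono hDK, ⟨connOn_compEdges _ _, hKe⟩,
      ⟨connOn_sdiff_compEdges hS.connOn hD.2.1 hDS hD.1 x,
        fun v => even_degIn_sdiff hKS (hS.even v) (hKe v)⟩⟩
  have hcard : (G.compEdges (S \ D) x).card = 1 := by
    have := Finset.card_le_card hDK
    have := hone _ hK
    omega
  obtain ⟨f', hf'⟩ := Finset.card_eq_one.1 hcard
  obtain rfl : f = f' := by simpa [hf'] using hfK
  have hodd := hirr _ hK
  obtain ⟨w, hw, hw'⟩ := hS.connOn.exists_common hK.subset hK.nonempty hK.nonempty'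
  simp only [hf'] at hKe hodd hw hw'
  obtain ⟨u, hu⟩ := exists_loop_of_even fun v => by simpa [degIn_singleton] using hKe v
  obtain rfl : w = u := by simpa [support_loop hu] using hw
  obtain rfl : x = w := by simpa [hu, Sym2.diag] using hx
  have huniq : ∀ g ∈ S \ D, x ∈ G.ends g → g = f := fun g hg hxg => by
    have : g ∈ G.compEdges (S \ D) x := mem_compEdges_of_mem hg hxg .refl
    simpa [hf'] using this
  refine ⟨x, ?_, ⟨hu, ?_⟩, huniq⟩
  · obtain ⟨g, hg, hxg⟩ := mem_support.1 hw'
    obtain ⟨hgS, hgf⟩ := Finset.mem_sdiff.1 hg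
    by_cases hgD : g ∈ D
    · exact mem_support_of_mem hgD hxg
    · exact absurd (huniq g (Finset.mem_sdiff.2 ⟨hgS, hgD⟩) hxg) (by simpa using hgf)
  · by_contra hneg
    simp [negEdges, Finset.filter_singleton, hneg] at hodd

theorem isEuler_of_loops {S : Finset G.E} {w : G.V} (h : ∀ e ∈ S, G.ends e = Sym2.diag w) :
    G.IsEuler S where
  connOn u hu v hv := by
    have : ∀ u ∈ G.support S, u = w := by
      intro u hu
      obtain ⟨e, he, hu⟩ := mem_support.1 hu
      simpa [h e he, Sym2.diag] using hu
    rw [this u hu, this v hv]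
    exact .refl
  even v := by
    rw [degIn_eq_sum_inc]
    exact Finset.even_sum _ fun e he => even_inc_loop (h e he) v

theorem hasSCDC_of_loops {S : Finset G.E} (hS : G.IsEuler S) (hneg : Even (G.negEdges S).card)
    (hirr : ∀ Y, G.EulerSplit S Y → Odd (G.negEdges Y).card)
    (hl : ∀ e ∈ S, ∃ w, G.ends e = Sym2.diag w) : G.HasSCDC S := by
  rcases S.eq_empty_or_nonempty with rfl | ⟨f, hf⟩
  · exact hasSCDC_empty
  obtain ⟨w, hw⟩ := hl f hf
  by_cases hSf : S = {f}
  · subst hSf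
    exact IsSignedCircuit.hasSCDC (Or.inl ⟨isCircuit_loop hw, hneg⟩)
  have hall : ∀ e ∈ S, G.ends e = Sym2.diag w := by
    intro e he
    obtain ⟨v, hv⟩ := hl e he
    have hwv : G.Reach S w v := hS.connOn w (mem_support_of_mem hf (by simp [hw, Sym2.diag])) v
      (mem_support_of_mem he (by simp [hv, Sym2.diag]))
    have : ∀ u, G.Reach S w u → w = u := by
      intro u hu
      induction hu with
      | refl => rfl
      | tail _ hbc ih =>
        obtain ⟨g, hg, hbc⟩ := hbc
        obtain ⟨z, hz⟩ := hl g hg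
        rw [hz] at hbc
        have := Sym2.eq_iff.1 hbc
        rw [ih]
        rcases this with ⟨h1, h2⟩ | ⟨h1, h2⟩ <;> rw [← h1, ← h2]
    rw [hv, this v hwv]
  have hsplit : ∀ Y ⊆ S, Y.Nonempty → (S \ Y).Nonempty → G.EulerSplit S Y := fun Y hY h1 h2 =>
    ⟨hY, h1, h2, isEuler_of_loops fun e he => hall e (hY he),
      isEuler_of_loops fun e he => hall e (Finset.sdiff_subset he)⟩
  obtain ⟨g, hg, hgf⟩ : ∃ g ∈ S, g ≠ f := by
    by_contra! h
    exact hSf (Finset.eq_singleton_iff_unique_mem.2 ⟨hf, h⟩)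
  have hnl : ∀ e ∈ S, G.negLoop w e := by
    intro e he
    refine ⟨hall e he, ?_⟩
    by_contra hne
    have hodd := hirr {e} (hsplit {e} (by simpa using he) (by simp) (by
      by_cases h : e = f
      · exact ⟨g, by simp [hg, h, hgf]⟩
      · exact ⟨f, by simp [hf, Ne.symm h]⟩))
    simp [negEdges, Finset.filter_singleton, hne] at hodd
  have hSfg : S = {f} ∪ {g} := by
    by_contra hne
    have hsub : ({f} ∪ {g} : Finset G.E) ⊆ S := by
      intro e he
      rcases Finset.mem_union.1 he with h | h <;> rw [Finset.mem_singleton.1 h] <;> assumption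
    have hodd := hirr _ (hsplit _ hsub (by simp)
      (Finset.sdiff_nonempty.2 fun h => hne (h.antisymm hsub)))
    rw [card_negEdges_union (by simpa using hgf.symm), negEdges_singleton (hnl f hf),
      negEdges_singleton (hnl g hg)] at hodd
    exact absurd hodd (by simp)
  rw [hSfg]
  exact ((isTadpole_loop (hnl f hf)).glue (isTadpole_loop (hnl g hg)) (by simpa using hgf.symm)
    (by simp [support_loop (hall f hf), support_loop (hall g hg)])).hasSCDC

/-- An even connected edge set with an even number of negative edges has a signed circuit double
cover, provided that enough negative loops outside of it are available at every vertex. -/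
theorem IsEuler.hasSCDC (n : ℕ) : ∀ S : Finset G.E, S.card = n → G.IsEuler S →
    Even (G.negEdges S).card → (∀ w, S.card ≤ (G.freeLoops S w).card + 1) → G.HasSCDC S := by
  induction n using Nat.strong_induction_on with
  | _ n ih =>
  intro S hn hS hneg hfree
  subst hn
  by_cases hirr : ∀ Y, G.EulerSplit S Y → Odd (G.negEdges Y).card
  swap
  · push Not at hirr
    obtain ⟨Y, hY, hYn⟩ := hirr
    have hYn := Nat.not_odd_iff_even.1 hYn
    have hsum := card_negEdges_sdiff_add hY.subset
    have hc := Finset.card_sdiff_add_card_eq_card hY.subset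
    have h1 := hY.nonempty.card_pos
    have h2 := hY.nonempty'.card_pos
    have hZn : Even (G.negEdges (S \ Y)).card := by
      rw [← hsum] at hneg
      exact (Nat.even_add.1 hneg).2 hYn
    have := (ih _ (by omega) Y rfl hY.left hYn fun w => by
      have := hfree w
      have := card_freeLoops_anti hY.subset w
      omega).union (ih _ (by omega) (S \ Y) rfl hY.right hZn fun w => by
      have := hfree w
      have := card_freeLoops_anti (Finset.sdiff_subset (s := S) (t := Y)) w
      omega) Finset.disjoint_sdiff
    rwa [Finset.union_sdiff_of_subset hY.subset] at this
  by_cases hone : ∀ Y, G.EulerSplit S Y → Y.card = 1 ∨ (S \ Y).card = 1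
  swap
  · push Not at hone
    obtain ⟨Y, hY, hY1, hY2⟩ := hone
    have hc := Finset.card_sdiff_add_card_eq_card hY.subset
    have h1 := hY.nonempty.card_pos
    have h2 := hY.nonempty'.card_pos
    obtain ⟨w, hw⟩ := hY.inter_eq hS hirr
    obtain ⟨hw1, hw2⟩ := mem_of_inter_eq hw
    obtain ⟨l, hl⟩ : (G.freeLoops S w).Nonempty := Finset.card_pos.1 (by
      have := hfree w
      omega)
    obtain ⟨hl, hlS⟩ := mem_freeLoops.1 hl
    have key : ∀ X ⊆ S, X.card + 2 ≤ S.card → G.IsEuler X → Odd (G.negEdges X).card →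
        w ∈ G.support X → G.RootedCover X w := by
      intro X hXS hXc hX hXn hwX
      have hlX : l ∉ X := fun h => hlS (hXS h)
      have hcX := Finset.card_insert_of_notMem hlX
      refine (ih _ ?_ (insert l X) rfl (hX.insert_loop hwX hl.1 hlX) ?_ fun v => ?_).rootedCover
        hlX hl
      · omega
      · rw [card_negEdges_insert_loop hl hlX]
        exact hXn.add_one
      · have := hfree v
        have := card_freeLoops_anti hXS v
        have := card_freeLoops_insert (S := X) l v
        omega
    have := (key Y hY.subset (by omega) hY.left (hirr Y hY) hw1).glue
      (key (S \ Y) Finset.sdiff_subset (by omega) hY.right (hirr _ hY.symm) hw2)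
      Finset.disjoint_sdiff fun v h1 h2 => eq_of_inter_eq hw h1 h2
    rwa [Finset.union_sdiff_of_subset hY.subset] at this
  by_cases hl : ∀ e ∈ S, ∃ w, G.ends e = Sym2.diag w
  · exact hasSCDC_of_loops hS hneg hirr hl
  · push Not at hl
    obtain ⟨e, he, hne⟩ := hl
    obtain ⟨x, y, hxy, hee⟩ := exists_ends_of_not_loop hne
    obtain ⟨D, hDS, hD, hD2⟩ := exists_isCircuit hS.even he hee hxy
    have key := fun f (hf : f ∈ S \ D) => loop_of_notMem_circuit hS hirr hone hDS hD hD2 hf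
    have hDL : D ∪ S \ D = S := Finset.union_sdiff_of_subset hDS
    rw [← hDL]
    refine hD.hasSCDC_union Finset.disjoint_sdiff (fun f hf => ?_) (fun f hf g hg w hfw hgw => ?_)
      (by rwa [hDL])
    · obtain ⟨w, hw, hfw, -⟩ := key f hf
      exact ⟨w, hw, hfw⟩
    · obtain ⟨v, -, hfv, huniq⟩ := key f hf
      obtain rfl : w = v := Sym2.diag_injective (hfw.1.symm.trans hfv.1)
      exact (huniq g hg (by simp [hgw.1, Sym2.diag])).symm

/-! ### Generalized barbells described by a class map -/

section ClassMap

variable {ι : Type*}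

/-- The ends of `e` lie in different classes. -/
def IsOuter (G : SignedMultigraph) (c : G.V → ι) (e : G.E) : Prop :=
  ∃ u ∈ G.ends e, ∃ v ∈ G.ends e, c u ≠ c v

/-- The edges of `S` inside a class. -/
def innerEdges (G : SignedMultigraph) (c : G.V → ι) (S : Finset G.E) : Finset G.E :=
  S.filter fun e => ¬ G.IsOuter c e

/-- The edges of `S` inside the class `i`. -/
def classEdges (G : SignedMultigraph) (c : G.V → ι) (S : Finset G.E) (i : ι) : Finset G.E :=
  S.filter fun e => ∀ v ∈ G.ends e, c v = i

/-- The edges of `S` leaving the class `i`. -/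
def outerAt (G : SignedMultigraph) (c : G.V → ι) (S : Finset G.E) (i : ι) : Finset G.E :=
  S.filter fun e => G.IsOuter c e ∧ ∃ v ∈ G.ends e, c v = i

variable {c : G.V → ι} {S : Finset G.E} {e : G.E} {i : ι} {u v : G.V}

theorem mem_innerEdges : e ∈ G.innerEdges c S ↔ e ∈ S ∧ ¬ G.IsOuter c e := Finset.mem_filter

theorem mem_classEdges : e ∈ G.classEdges c S i ↔ e ∈ S ∧ ∀ v ∈ G.ends e, c v = i :=
  Finset.mem_filter

theorem mem_outerAt :
    e ∈ G.outerAt c S i ↔ e ∈ S ∧ G.IsOuter c e ∧ ∃ v ∈ G.ends e, c v = i := Finset.mem_filter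

theorem not_isOuter_of_forall (h : ∀ v ∈ G.ends e, c v = i) : ¬ G.IsOuter c e := by
  rintro ⟨u, hu, v, hv, huv⟩
  exact huv ((h u hu).trans (h v hv).symm)

theorem eq_of_not_isOuter (h : ¬ G.IsOuter c e) (hu : u ∈ G.ends e) (hv : v ∈ G.ends e) :
    c u = c v := by
  by_contra hne
  exact h ⟨u, hu, v, hv, hne⟩

theorem mem_classEdges_of_mem (he : e ∈ S) (h : ¬ G.IsOuter c e) (hv : v ∈ G.ends e)
    (hi : c v = i) : e ∈ G.classEdges c S i :=
  mem_classEdges.2 ⟨he, fun _ hu => (eq_of_not_isOuter h hu hv).trans hi⟩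

theorem classEdges_subset_innerEdges : G.classEdges c S i ⊆ G.innerEdges c S := fun _ he =>
  mem_innerEdges.2 ⟨(mem_classEdges.1 he).1, not_isOuter_of_forall (mem_classEdges.1 he).2⟩

theorem class_of_mem_support (h : v ∈ G.support (G.classEdges c S i)) : c v = i := by
  obtain ⟨e, he, hv⟩ := mem_support.1 h
  exact (mem_classEdges.1 he).2 v hv

theorem Reach.class_eq (h : G.Reach (G.innerEdges c S) u v) : c u = c v := by
  induction h with
  | refl => rfl
  | tail _ hbc ih =>
    obtain ⟨e, he, hbc⟩ := hbc
    exact ih.trans (eq_of_not_isOuter (mem_innerEdges.1 he).2 (by simp [hbc]) (by simp [hbc]))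

theorem Reach.classEdges (h : G.Reach (G.innerEdges c S) u v) (hi : c u = i) :
    G.Reach (G.classEdges c S i) u v := by
  induction h with
  | refl => exact .refl
  | tail hb hbc ih =>
    obtain ⟨e, he, hbc⟩ := hbc
    obtain ⟨heS, he⟩ := mem_innerEdges.1 he
    exact ih.tail ⟨e, mem_classEdges_of_mem heS he (by simp [hbc])
      ((Reach.class_eq hb).symm.trans hi), hbc⟩

/-- The combinatorial properties of a generalized barbell `S` whose contracted classes are the
fibres of `c`, together with a supply of negative loops outside of `S`. -/
structure IsClassBarbell (G : SignedMultigraph) (c : G.V → ι) (S : Finset G.E) : Prop where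
  even : ∀ v, Even (G.degIn (G.innerEdges c S) v)
  reach : ∀ u ∈ G.support S, ∀ v ∈ G.support S, c u = c v → G.Reach (G.innerEdges c S) u v
  parity : ∀ i, Even ((G.negEdges (G.classEdges c S i)).card + (G.outerAt c S i).card)
  acyclic : ∀ F ⊆ S, F.Nonempty → (∀ e ∈ F, G.IsOuter c e) → ∃ i, (G.outerAt c F i).card = 1
  free : ∀ w, S.card ≤ (G.freeLoops S w).card

theorem even_degIn_classEdges (h : Even (G.degIn (G.innerEdges c S) v)) :
    Even (G.degIn (G.classEdges c S i) v) := by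
  by_cases hv : v ∈ G.support (G.classEdges c S i)
  · have hi := class_of_mem_support hv
    have : G.degIn (G.classEdges c S i) v = G.degIn (G.innerEdges c S) v := by
      rw [degIn_eq_sum_inc, degIn_eq_sum_inc]
      refine Finset.sum_subset classEdges_subset_innerEdges fun e he hne => ?_
      rw [inc_eq_zero]
      obtain ⟨heS, he⟩ := mem_innerEdges.1 he
      exact fun hve => hne (mem_classEdges_of_mem heS he hve hi)
    rwa [this]
  · rw [degIn_eq_zero.2 hv]
    exact Even.zero

theorem IsClassBarbell.isEuler (h : G.IsClassBarbell c S) (i : ι) :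
    G.IsEuler (G.classEdges c S i) where
  connOn u hu v hv := by
    have hsub : G.classEdges c S i ⊆ S := Finset.filter_subset _ _
    have hui := class_of_mem_support hu
    exact (h.reach u (support_mono hsub hu) v (support_mono hsub hv)
      (hui.trans (class_of_mem_support hv).symm)).classEdges hui
  even v := even_degIn_classEdges (h.even v)

theorem IsClassBarbell.sdiff (h : G.IsClassBarbell c S) (hS : ∀ e ∈ S, ¬ G.IsOuter c e) :
    G.IsClassBarbell c (S \ G.classEdges c S i) := by
  have hsub : G.classEdges c S i ⊆ S := Finset.filter_subset _ _
  have hin : ∀ T ⊆ S, G.innerEdges c T = T := fun T hT =>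
    Finset.filter_true_of_mem fun e he => hS e (hT he)
  have hout : ∀ T ⊆ S, ∀ j, G.outerAt c T j = ∅ := fun T hT j => by
    ext e
    simp only [mem_outerAt, Finset.notMem_empty, iff_false]
    exact fun h => hS e (hT h.1) h.2.1
  have hclass : ∀ j ≠ i, G.classEdges c (S \ G.classEdges c S i) j = G.classEdges c S j := by
    intro j hj
    ext e
    simp only [mem_classEdges, Finset.mem_sdiff]
    refine ⟨fun h => ⟨h.1.1, h.2⟩, fun h => ⟨⟨h.1, fun h' => hj ?_⟩, h.2⟩⟩
    have hm := Sym2.out_fst_mem (G.ends e)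
    exact (h.2 _ hm).symm.trans (h'.2 _ hm)
  have hsd : S \ G.classEdges c S i ⊆ S := Finset.sdiff_subset
  constructor
  · intro v
    rw [hin _ hsd]
    exact even_degIn_sdiff hsub (by simpa [hin S subset_rfl] using h.even v) ((h.isEuler i).even v)
  · intro u hu v hv huv
    have hui : c u ≠ i := by
      intro hui
      obtain ⟨e, he, hue⟩ := mem_support.1 hu
      obtain ⟨heS, he⟩ := Finset.mem_sdiff.1 he
      exact he (mem_classEdges_of_mem heS (hS e heS) hue hui)
    have := (h.reach u (support_mono hsd hu) v (support_mono hsd hv) huv).classEdges rfl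
    rw [← hclass _ hui] at this
    exact this.mono classEdges_subset_innerEdges
  · intro j
    rw [hout _ hsd, Finset.card_empty, add_zero]
    by_cases hj : j = i
    · subst hj
      have : G.classEdges c (S \ G.classEdges c S j) j = ∅ := by
        ext e
        simp only [mem_classEdges, Finset.mem_sdiff, Finset.notMem_empty, iff_false]
        tauto
      simp [this, negEdges]
    · rw [hclass j hj]
      simpa [hout S subset_rfl] using h.parity j
  · exact fun F hF => h.acyclic F (hF.trans hsd)
  · exact fun w => (Finset.card_le_card hsd).trans ((h.free w).trans (card_freeLoops_anti hsd w))

/-- Deleting a class that meets a single outer edge `e`, together with `e`, and attaching a negative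
loop at the other end of `e`. -/
theorem IsClassBarbell.prune (h : G.IsClassBarbell c S) {x y : G.V} {l : G.E}
    (hS : (G.classEdges c S i).Nonempty) (he : G.outerAt c S i = {e}) (hxy : G.ends e = s(x, y))
    (hy : c y ≠ i) (hl : G.negLoop y l) (hlS : l ∉ S) :
    G.IsClassBarbell c (insert l (S \ insert e (G.classEdges c S i))) := by
  set B := G.classEdges c S i with hB
  set S₁ := S \ insert e B with hS₁
  have heS : e ∈ S ∧ G.IsOuter c e ∧ ∃ v ∈ G.ends e, c v = i :=
    mem_outerAt.1 (by simp [he])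
  have hBS : B ⊆ S := Finset.filter_subset _ _
  have hS₁S : S₁ ⊆ S := Finset.sdiff_subset
  have hlS₁ : l ∉ S₁ := fun h => hlS (hS₁S h)
  have hlends : ∀ v ∈ G.ends l, v = y := fun v hv => by simpa [hl.1, Sym2.diag] using hv
  have hlout : ¬ G.IsOuter c l := not_isOuter_of_forall fun v hv => by rw [hlends v hv]
  have heB : e ∉ B := fun h => not_isOuter_of_forall (mem_classEdges.1 h).2 heS.2.1
  have hyS : y ∈ G.support S := mem_support_of_mem heS.1 (by simp [hxy])
  have hnot : ∀ f ∈ S₁, ∀ v ∈ G.ends f, c v ≠ i := by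
    intro f hf v hv hvi
    obtain ⟨hfS, hf⟩ := Finset.mem_sdiff.1 hf
    rw [Finset.mem_insert, not_or] at hf
    by_cases hfo : G.IsOuter c f
    · have : f ∈ G.outerAt c S i := mem_outerAt.2 ⟨hfS, hfo, v, hv, hvi⟩
      exact hf.1 (by simpa [he] using this)
    · exact hf.2 (mem_classEdges_of_mem hfS hfo hv hvi)
  have hsupp : ∀ v ∈ G.support (insert l S₁), v ∈ G.support S ∧ c v ≠ i := by
    intro v hv
    obtain ⟨f, hf, hvf⟩ := mem_support.1 hv
    rcases Finset.mem_insert.1 hf with rfl | hf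
    · rw [hlends v hvf]
      exact ⟨hyS, hy⟩
    · exact ⟨mem_support_of_mem (hS₁S hf) hvf, hnot f hf v hvf⟩
  have hmem₁ : ∀ f ∈ S, ∀ v ∈ G.ends f, c v ≠ i → f ≠ e → f ∈ S₁ := by
    intro f hf v hv hvi hfe
    refine Finset.mem_sdiff.2 ⟨hf, ?_⟩
    rw [Finset.mem_insert, not_or]
    exact ⟨hfe, fun h => hvi ((mem_classEdges.1 h).2 v hv)⟩
  have hclass : ∀ j ≠ i, G.classEdges c S₁ j = G.classEdges c S j := by
    intro j hj
    ext f
    simp only [mem_classEdges]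
    refine ⟨fun h => ⟨hS₁S h.1, h.2⟩, fun h => ⟨?_, h.2⟩⟩
    refine hmem₁ f h.1 _ (Sym2.out_fst_mem _) (by rw [h.2 _ (Sym2.out_fst_mem _)]; exact hj) ?_
    rintro rfl
    exact not_isOuter_of_forall h.2 heS.2.1
  have hinner : G.innerEdges c (insert l S₁) = insert l (G.innerEdges c S \ B) := by
    ext f
    simp only [mem_innerEdges, Finset.mem_insert, Finset.mem_sdiff, hS₁]
    constructor
    · rintro ⟨rfl | h, h'⟩ <;> tauto
    · rintro (rfl | ⟨⟨h1, h2⟩, h3⟩)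
      · exact ⟨Or.inl rfl, hlout⟩
      · refine ⟨Or.inr ⟨h1, ?_⟩, h2⟩
        rintro (rfl | h)
        · exact h2 heS.2.1
        · exact h3 h
  have houter : ∀ j, G.outerAt c (insert l S₁) j = G.outerAt c S j \ {e} := by
    intro j
    ext f
    simp only [mem_outerAt, Finset.mem_insert, Finset.mem_sdiff, Finset.mem_singleton, hS₁]
    constructor
    · rintro ⟨rfl | h, h'⟩
      · exact absurd h'.1 hlout
      · tauto
    · rintro ⟨⟨h1, h2, h3⟩, h4⟩
      refine ⟨Or.inr ⟨h1, ?_⟩, h2, h3⟩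
      rintro (h | h)
      · exact h4 h
      · exact not_isOuter_of_forall (mem_classEdges.1 h).2 h2
  constructor
  · intro v
    have hBin : B ⊆ G.innerEdges c S := classEdges_subset_innerEdges
    rw [hinner, Finset.insert_eq, degIn_union, degIn_singleton]
    · exact (even_inc_loop hl.1 v).add
        (even_degIn_sdiff hBin (h.even v) ((h.isEuler i).even v))
    · rw [Finset.disjoint_singleton_left]
      exact fun h => hlS (mem_innerEdges.1 (Finset.mem_sdiff.1 h).1).1
  · intro u hu v hv huv
    obtain ⟨huS, hui⟩ := hsupp u hu
    have := (h.reach u huS v (hsupp v hv).1 huv).classEdges rfl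
    rw [← hclass _ hui] at this
    refine (this.mono classEdges_subset_innerEdges).mono ?_
    exact Finset.filter_subset_filter _ (Finset.subset_insert _ _)
  · intro j
    have hp := h.parity j
    rw [houter]
    by_cases hji : j = i
    · subst hji
      have hempty : G.classEdges c (insert l S₁) j = ∅ := by
        ext f
        simp only [mem_classEdges, Finset.notMem_empty, iff_false]
        rintro ⟨hf, hfj⟩
        obtain ⟨v, hv⟩ : ∃ v, v ∈ G.ends f := ⟨_, Sym2.out_fst_mem _⟩
        exact (hsupp v (mem_support_of_mem hf hv)).2 (hfj v hv)
      simp [hempty, he, negEdges]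
    · by_cases hjy : j = c y
      · have hins : G.classEdges c (insert l S₁) j = insert l (G.classEdges c S j) := by
          rw [← hclass j hji]
          ext f
          simp only [mem_classEdges, Finset.mem_insert]
          constructor
          · tauto
          · rintro (rfl | h)
            · exact ⟨Or.inl rfl, fun v hv => by rw [hlends v hv, hjy]⟩
            · tauto
        have hej : ({e} : Finset G.E) ⊆ G.outerAt c S j := by
          rw [Finset.singleton_subset_iff]
          exact mem_outerAt.2 ⟨heS.1, heS.2.1, y, by simp [hxy], hjy.symm⟩
        have hcard := Finset.card_sdiff_add_card_eq_card hej
        rw [Finset.card_singleton] at hcard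
        rw [hins, card_negEdges_insert_loop hl fun h => hlS (mem_classEdges.1 h).1]
        rwa [← hcard, ← add_assoc, add_right_comm] at hp
      · have hins : G.classEdges c (insert l S₁) j = G.classEdges c S j := by
          rw [← hclass j hji]
          ext f
          simp only [mem_classEdges, Finset.mem_insert]
          constructor
          · rintro ⟨rfl | h, h'⟩
            · exact absurd (h' y (by simp [hl.1, Sym2.diag])).symm hjy
            · exact ⟨h, h'⟩
          · tauto
        have hej : e ∉ G.outerAt c S j := by
          intro hej
          obtain ⟨-, -, v, hv, hvj⟩ := mem_outerAt.1 hej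
          obtain ⟨w, hw, hwi⟩ := heS.2.2
          rw [hxy, Sym2.mem_iff] at hv hw
          rcases hv with rfl | rfl <;> rcases hw with rfl | rfl
          · exact hji (hvj.symm.trans hwi)
          · exact hy hwi
          · exact hjy hvj.symm
          · exact hy hwi
        rw [hins, Finset.sdiff_singleton_eq_erase, Finset.erase_eq_of_notMem hej]
        exact hp
  · intro F hF hne hout
    refine h.acyclic F (fun f hf => ?_) hne hout
    rcases Finset.mem_insert.1 (hF hf) with rfl | h
    · exact absurd (hout _ hf) hlout
    · exact hS₁S h
  · intro w
    have h1 := card_freeLoops_insert (S := S₁) l w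
    have h2 := card_freeLoops_anti hS₁S w
    have h3 := h.free w
    have h4 := Finset.card_insert_of_notMem hlS₁
    have h5 : insert e B ⊆ S := Finset.insert_subset heS.1 hBS
    have h6 := Finset.card_sdiff_add_card_eq_card h5
    rw [← hS₁] at h6
    have h7 := Finset.card_insert_of_notMem heB
    have h8 := hS.card_pos
    omega

theorem IsClassBarbell.hasSCDC (n : ℕ) : ∀ S : Finset G.E, S.card = n →
    G.IsClassBarbell c S → G.HasSCDC S := by
  induction n using Nat.strong_induction_on with
  | _ n ih =>
  intro S hn h
  subst hn
  rcases S.eq_empty_or_nonempty with rfl | hSne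
  · exact hasSCDC_empty
  by_cases hS : ∀ e ∈ S, ¬ G.IsOuter c e
  · obtain ⟨e, he⟩ := hSne
    obtain ⟨v, hv⟩ : ∃ v, v ∈ G.ends e := ⟨_, Sym2.out_fst_mem _⟩
    have hsub : G.classEdges c S (c v) ⊆ S := Finset.filter_subset _ _
    have heB : e ∈ G.classEdges c S (c v) := mem_classEdges_of_mem he (hS e he) hv rfl
    have hout : G.outerAt c S (c v) = ∅ := by
      ext f
      simp only [mem_outerAt, Finset.notMem_empty, iff_false]
      exact fun h => hS f h.1 h.2.1
    have h1 : G.HasSCDC (G.classEdges c S (c v)) :=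
      IsEuler.hasSCDC _ _ rfl (h.isEuler _) (by simpa [hout] using h.parity (c v)) fun w => by
        have := h.free w
        have := Finset.card_le_card hsub
        have := card_freeLoops_anti hsub w
        omega
    have hc := Finset.card_sdiff_add_card_eq_card hsub
    have hpos := Finset.card_pos.2 ⟨e, heB⟩
    have := h1.union (ih _ (by omega) _ rfl (h.sdiff hS)) Finset.disjoint_sdiff
    rwa [Finset.union_sdiff_of_subset hsub] at this
  · push Not at hS
    obtain ⟨f, hf, hfo⟩ := hS
    obtain ⟨i, hi⟩ := h.acyclic (S.filter (G.IsOuter c)) (Finset.filter_subset _ _)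
      ⟨f, Finset.mem_filter.2 ⟨hf, hfo⟩⟩ fun e he => (Finset.mem_filter.1 he).2
    have : G.outerAt c (S.filter (G.IsOuter c)) i = G.outerAt c S i := by
      ext e
      simp only [mem_outerAt, Finset.mem_filter]
      tauto
    rw [this] at hi
    obtain ⟨e, he⟩ := Finset.card_eq_one.1 hi
    obtain ⟨heS, heo, x, hx, hxi⟩ := mem_outerAt.1 (by simp [he] : e ∈ G.outerAt c S i)
    obtain ⟨y, hxy⟩ := Sym2.mem_iff_exists.1 hx
    have hy : c y ≠ i := by
      intro hyi
      refine not_isOuter_of_forall (i := i) (fun v hv => ?_) heo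
      rw [hxy, Sym2.mem_iff] at hv
      rcases hv with rfl | rfl
      · exact hxi
      · exact hyi
    have hBe := h.isEuler i
    have hBodd : Odd (G.negEdges (G.classEdges c S i)).card := by
      have := h.parity i
      rw [he, Finset.card_singleton, Nat.even_add_one] at this
      exact Nat.not_even_iff_odd.1 this
    have hP := fun {l : G.E} => h.prune (l := l) (e := e) (x := x) (y := y) (i := i)
    set B := G.classEdges c S i with hB
    have hBne : B.Nonempty := by
      obtain ⟨b, hb⟩ := Finset.card_pos.1 hBodd.pos
      exact ⟨b, Finset.filter_subset _ _ hb⟩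
    have hBS : B ⊆ S := Finset.filter_subset _ _
    have heB : e ∉ B := fun h => not_isOuter_of_forall (mem_classEdges.1 h).2 heo
    have hxB : x ∈ G.support B := by
      obtain ⟨u, hu⟩ := support_nonempty hBne
      have hui := class_of_mem_support hu
      exact ((h.reach u (support_mono hBS hu) x (mem_support_of_mem heS hx)
        (hui.trans hxi.symm)).classEdges hui).mem_support hu
    have heBS : insert e B ⊆ S := Finset.insert_subset heS hBS
    have hcS := Finset.card_sdiff_add_card_eq_card heBS
    have hceB := Finset.card_insert_of_notMem heB
    have hBpos := hBne.card_pos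
    obtain ⟨k, hk⟩ : (G.freeLoops S x).Nonempty :=
      Finset.card_pos.1 (hSne.card_pos.trans_le (h.free x))
    obtain ⟨l, hl⟩ : (G.freeLoops S y).Nonempty :=
      Finset.card_pos.1 (hSne.card_pos.trans_le (h.free y))
    obtain ⟨hk, hkS⟩ := mem_freeLoops.1 hk
    obtain ⟨hl, hlS⟩ := mem_freeLoops.1 hl
    have hkB : k ∉ B := fun h => hkS (hBS h)
    have hX : G.RootedCover (insert e B) y := by
      refine (HasSCDC.rootedCover ?_ hkB hk).extend (hxy.trans Sym2.eq_swap)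
        fun hyB => hy (class_of_mem_support hyB)
      refine IsEuler.hasSCDC _ _ rfl (hBe.insert_loop hxB hk.1 hkB) ?_ fun w => ?_
      · rw [card_negEdges_insert_loop hk hkB]
        exact hBodd.add_one
      · have := h.free w
        have := card_freeLoops_anti hBS w
        have := card_freeLoops_insert (S := B) k w
        have := Finset.card_insert_of_notMem hkB
        omega
    have hlS₁ : l ∉ S \ insert e B := fun h => hlS (Finset.sdiff_subset h)
    have hY : G.RootedCover (S \ insert e B) y := by
      refine (ih _ ?_ _ rfl (hP hBne he hxy hy hl hlS)).rootedCover hlS₁ hl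
      rw [Finset.card_insert_of_notMem hlS₁]
      omega
    have := hX.glue hY Finset.disjoint_sdiff fun v hv hv' => ?_
    · rwa [Finset.union_sdiff_of_subset heBS] at this
    · by_contra hvy
      have hvi : c v = i := by
        rw [Finset.insert_eq, support_union, Finset.mem_union, mem_support_singleton, hxy,
          Sym2.mem_iff] at hv
        rcases hv with (rfl | h) | h
        · exact hxi
        · exact absurd h hvy
        · exact class_of_mem_support h
      obtain ⟨g, hg, hvg⟩ := mem_support.1 hv'
      obtain ⟨hgS, hg⟩ := Finset.mem_sdiff.1 hg
      rw [Finset.mem_insert, not_or] at hg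
      by_cases hgo : G.IsOuter c g
      · have : g ∈ G.outerAt c S i := mem_outerAt.2 ⟨hgS, hgo, v, hvg, hvi⟩
        exact hg.1 (by simpa [he] using this)
      · exact hg.2 (mem_classEdges_of_mem hgS hgo hvg hvi)

end ClassMap

/-! ### The class map of a generalized barbell -/

section Witness

variable {ℬ : Finset (Finset G.E)} {u v : G.V} {e : G.E}

theorem mem_classOf :
    u ∈ G.classOf ℬ v ↔ u = v ∨ ∃ B ∈ ℬ, v ∈ G.support B ∧ u ∈ G.support B := by
  simp [classOf]

theorem classOf_eq_support (hd : ∀ B₁ ∈ ℬ, ∀ B₂ ∈ ℬ, B₁ ≠ B₂ →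
    Disjoint (G.support B₁) (G.support B₂)) {B : Finset G.E} (hB : B ∈ ℬ)
    (hv : v ∈ G.support B) : G.classOf ℬ v = G.support B := by
  ext u
  rw [mem_classOf]
  constructor
  · rintro (rfl | ⟨B', hB', hv', hu⟩)
    · exact hv
    · by_cases h : B' = B
      · rwa [← h]
      · exact absurd hv (Finset.disjoint_left.1 (hd _ hB' _ hB h) hv')
  · exact fun hu => Or.inr ⟨B, hB, hv, hu⟩

theorem classOf_eq_iff (hd : ∀ B₁ ∈ ℬ, ∀ B₂ ∈ ℬ, B₁ ≠ B₂ →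
    Disjoint (G.support B₁) (G.support B₂)) :
    G.classOf ℬ u = G.classOf ℬ v ↔ u ∈ G.classOf ℬ v := by
  constructor
  · intro h
    rw [← h]
    exact mem_classOf.2 (Or.inl rfl)
  · intro h
    rcases mem_classOf.1 h with rfl | ⟨B, hB, hv, hu⟩
    · rfl
    · rw [classOf_eq_support hd hB hv, classOf_eq_support hd hB hu]

theorem sum_inc_of_not_isOuter (hd : ∀ B₁ ∈ ℬ, ∀ B₂ ∈ ℬ, B₁ ≠ B₂ →
    Disjoint (G.support B₁) (G.support B₂)) (h : ¬ G.IsOuter (G.classOf ℬ) e) (v : G.V) :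
    ∑ u ∈ G.classOf ℬ v, G.inc e u ≠ 1 := by
  by_cases hv : ∃ a ∈ G.ends e, a ∈ G.classOf ℬ v
  · obtain ⟨a, ha, hav⟩ := hv
    have : ∑ u ∈ G.classOf ℬ v, G.inc e u = ∑ u, G.inc e u := by
      refine Finset.sum_subset (Finset.subset_univ _) fun u _ hu => ?_
      rw [inc_eq_zero]
      intro hue
      rw [← classOf_eq_iff hd] at hu hav
      exact hu ((eq_of_not_isOuter h hue ha).trans hav)
    rw [this, sum_inc]
    norm_num
  · push Not at hv
    rw [Finset.sum_eq_zero fun u hu => inc_eq_zero.2 fun hue => hv u hue hu]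
    norm_num

theorem sum_inc_of_isOuter (hd : ∀ B₁ ∈ ℬ, ∀ B₂ ∈ ℬ, B₁ ≠ B₂ →
    Disjoint (G.support B₁) (G.support B₂)) (h : G.IsOuter (G.classOf ℬ) e) (v : G.V) :
    ∑ u ∈ G.classOf ℬ v, G.inc e u =
      if ∃ a ∈ G.ends e, G.classOf ℬ a = G.classOf ℬ v then 1 else 0 := by
  obtain ⟨x, hx, y, hy, hne⟩ := h
  have hxy : x ≠ y := fun h => hne (by rw [h])
  have he := (Sym2.mem_and_mem_iff hxy).1 ⟨hx, hy⟩
  split_ifs with hv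
  · obtain ⟨a, ha, hav⟩ := hv
    have haV := (classOf_eq_iff hd).1 hav
    rw [Finset.sum_eq_single_of_mem a haV fun u hu hua => ?_]
    · rw [inc_link he hxy, if_pos (by simpa [he] using ha)]
    · rw [inc_eq_zero, he, Sym2.mem_iff]
      rw [he, Sym2.mem_iff] at ha
      have huv := (classOf_eq_iff hd).2 hu
      rintro (rfl | rfl) <;> rcases ha with rfl | rfl
      · exact hua rfl
      · exact hne (huv.trans hav.symm)
      · exact hne (hav.trans huv.symm)
      · exact hua rfl
  · exact Finset.sum_eq_zero fun u hu => inc_eq_zero.2 fun hue =>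
      hv ⟨u, hue, (classOf_eq_iff hd).2 hu⟩

theorem crossesB_eq_true {A : Finset G.V} :
    G.crossesB A e = true ↔ (∃ u ∈ G.ends e, u ∈ A) ∧ ∃ v ∈ G.ends e, v ∉ A := by
  obtain ⟨x, y, hxy⟩ : ∃ x y, G.ends e = s(x, y) :=
    Sym2.inductionOn (G.ends e) fun x y => ⟨x, y, rfl⟩
  simp only [crossesB, hxy, Sym2.lift_mk, Sym2.mem_iff]
  by_cases h1 : x ∈ A <;> by_cases h2 : y ∈ A <;> simp [h1, h2]

theorem outerAt_classOf (hd : ∀ B₁ ∈ ℬ, ∀ B₂ ∈ ℬ, B₁ ≠ B₂ →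
    Disjoint (G.support B₁) (G.support B₂)) (S : Finset G.E) (v : G.V) :
    G.outerAt (G.classOf ℬ) S (G.classOf ℬ v) = G.boundary S (G.classOf ℬ v) := by
  ext e
  rw [mem_outerAt, boundary, Finset.mem_filter, crossesB_eq_true]
  simp only [← classOf_eq_iff hd]
  refine and_congr_right fun _ => ⟨?_, ?_⟩
  · rintro ⟨⟨x, hx, y, hy, hxy⟩, h⟩
    refine ⟨h, ?_⟩
    by_cases hxv : G.classOf ℬ x = G.classOf ℬ v
    · exact ⟨y, hy, fun h => hxy (hxv.trans h.symm)⟩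
    · exact ⟨x, hx, hxv⟩
  · rintro ⟨⟨x, hx, hxv⟩, y, hy, hyv⟩
    exact ⟨⟨x, hx, y, hy, fun h => hyv (h.symm.trans hxv)⟩, x, hx, hxv⟩

theorem GenBarbellWitness.exists_of_not_isOuter (h : G.GenBarbellWitness Finset.univ ℬ)
    (he : ¬ G.IsOuter (G.classOf ℬ) e) : ∃ B ∈ ℬ, e ∈ B := by
  by_contra! hne
  obtain ⟨v, hv⟩ := h.2.2.1 {e} (by simpa using hne) (by simp)
  refine sum_inc_of_not_isOuter h.2.1 he v ?_
  simpa only [classDeg, degIn_singleton] using hv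

theorem GenBarbellWitness.not_isOuter (h : G.GenBarbellWitness Finset.univ ℬ) {B : Finset G.E}
    (hB : B ∈ ℬ) (he : e ∈ B) : ¬ G.IsOuter (G.classOf ℬ) e :=
  not_isOuter_of_forall fun _ hv => classOf_eq_support h.2.1 hB (mem_support_of_mem he hv)

theorem GenBarbellWitness.subset_innerEdges (h : G.GenBarbellWitness Finset.univ ℬ)
    {B : Finset G.E} (hB : B ∈ ℬ) : B ⊆ G.innerEdges (G.classOf ℬ) Finset.univ :=
  fun _ he => mem_innerEdges.2 ⟨Finset.mem_univ _, h.not_isOuter hB he⟩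

theorem GenBarbellWitness.even (h : G.GenBarbellWitness Finset.univ ℬ) (v : G.V) :
    Even (G.degIn (G.innerEdges (G.classOf ℬ) Finset.univ) v) := by
  by_cases hv : ∃ B ∈ ℬ, v ∈ G.support B
  · obtain ⟨B, hB, hv⟩ := hv
    have : G.degIn B v = G.degIn (G.innerEdges (G.classOf ℬ) Finset.univ) v := by
      rw [degIn_eq_sum_inc, degIn_eq_sum_inc]
      refine Finset.sum_subset (h.subset_innerEdges hB) fun e he hne => ?_
      rw [inc_eq_zero]
      intro hve
      obtain ⟨B', hB', heB'⟩ := h.exists_of_not_isOuter (mem_innerEdges.1 he).2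
      by_cases hBB : B' = B
      · exact hne (hBB ▸ heB')
      · exact Finset.disjoint_left.1 (h.2.1 _ hB' _ hB hBB) (mem_support_of_mem heB' hve) hv
    rw [← this]
    exact (h.1 B hB).2.2.2 v hv
  · push Not at hv
    rw [degIn_eq_zero.2 ?_]
    · exact Even.zero
    · rw [mem_support]
      rintro ⟨e, he, hve⟩
      obtain ⟨B, hB, heB⟩ := h.exists_of_not_isOuter (mem_innerEdges.1 he).2
      exact hv B hB (mem_support_of_mem heB hve)

theorem GenBarbellWitness.reach (h : G.GenBarbellWitness Finset.univ ℬ)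
    (huv : G.classOf ℬ u = G.classOf ℬ v) :
    G.Reach (G.innerEdges (G.classOf ℬ) Finset.univ) u v := by
  rcases mem_classOf.1 ((classOf_eq_iff h.2.1).1 huv) with rfl | ⟨B, hB, hv, hu⟩
  · exact .refl
  · exact ((h.1 B hB).2.2.1 u hu v hv).mono (h.subset_innerEdges hB)

theorem GenBarbellWitness.parity (h : G.GenBarbellWitness Finset.univ ℬ) (i : Finset G.V) :
    Even ((G.negEdges (G.classEdges (G.classOf ℬ) Finset.univ i)).card +
      (G.outerAt (G.classOf ℬ) Finset.univ i).card) := by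
  have hinner : ∀ e ∈ G.classEdges (G.classOf ℬ) Finset.univ i, ∃ B ∈ ℬ, e ∈ B := fun e he =>
    h.exists_of_not_isOuter (not_isOuter_of_forall (mem_classEdges.1 he).2)
  by_cases hB : ∃ B ∈ ℬ, G.support B = i
  · obtain ⟨B, hB, rfl⟩ := hB
    obtain ⟨v, hv⟩ := support_nonempty (h.1 B hB).2.1
    have hBc : G.classEdges (G.classOf ℬ) Finset.univ (G.support B) = B := by
      ext e
      constructor
      · intro he
        obtain ⟨B', hB', heB'⟩ := hinner e he
        by_cases hBB : B' = B
        · rwa [← hBB]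
        · have ha := Sym2.out_fst_mem (G.ends e)
          have ha' := mem_support_of_mem heB' ha
          have := (mem_classEdges.1 he).2 _ ha
          rw [classOf_eq_support h.2.1 hB' ha'] at this
          rw [this] at ha'
          exact absurd ha' (Finset.disjoint_left.1 (h.2.1 _ hB' _ hB hBB)
            (mem_support_of_mem heB' ha))
      · exact fun he => mem_classEdges.2 ⟨Finset.mem_univ _, fun v hv =>
          classOf_eq_support h.2.1 hB (mem_support_of_mem he hv)⟩
    have ho := outerAt_classOf h.2.1 Finset.univ v
    rw [classOf_eq_support h.2.1 hB hv] at ho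
    rw [hBc, ho]
    have := h.2.2.2.1 B hB
    rw [Nat.ModEq] at this
    rw [Nat.even_iff]
    omega
  · push Not at hB
    have hempty : G.classEdges (G.classOf ℬ) Finset.univ i = ∅ := by
      rw [Finset.eq_empty_iff_forall_notMem]
      intro e he
      obtain ⟨B, hB', heB⟩ := hinner e he
      have ha := Sym2.out_fst_mem (G.ends e)
      exact hB B hB' ((classOf_eq_support h.2.1 hB' (mem_support_of_mem heB ha)).symm.trans
        ((mem_classEdges.1 he).2 _ ha))
    rw [hempty, negEdges, Finset.filter_empty, Finset.card_empty, zero_add]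
    rcases (G.outerAt (G.classOf ℬ) Finset.univ i).eq_empty_or_nonempty with h0 | ⟨e, he⟩
    · rw [h0]
      exact Even.zero
    · obtain ⟨-, -, v, hv, rfl⟩ := mem_outerAt.1 he
      have hvB : ∀ B ∈ ℬ, v ∉ G.support B := fun B hB' hv =>
        hB B hB' (classOf_eq_support h.2.1 hB' hv).symm
      have hcv : G.classOf ℬ v = {v} := by
        ext u
        rw [mem_classOf, Finset.mem_singleton, or_iff_left]
        rintro ⟨B, hB', hv, -⟩
        exact hvB B hB' hv
      rw [outerAt_classOf h.2.1, hcv]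
      exact h.2.2.2.2 v (mem_support_of_mem (Finset.mem_univ e) hv) hvB

theorem GenBarbellWitness.acyclic (h : G.GenBarbellWitness Finset.univ ℬ) {F : Finset G.E}
    (hF : F.Nonempty) (hout : ∀ e ∈ F, G.IsOuter (G.classOf ℬ) e) :
    ∃ i, (G.outerAt (G.classOf ℬ) F i).card = 1 := by
  obtain ⟨v, hv⟩ := h.2.2.1 F (fun e he => by
    simp only [Finset.mem_sdiff, Finset.mem_univ, Finset.mem_sup, id, true_and, not_exists, not_and]
    exact fun B hB heB => h.not_isOuter hB heB (hout e he)) hF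
  refine ⟨G.classOf ℬ v, ?_⟩
  rw [← hv, classDeg]
  simp only [degIn_eq_sum_inc]
  rw [Finset.sum_comm, Finset.sum_congr rfl fun e he => sum_inc_of_isOuter h.2.1 (hout e he) v,
    Finset.sum_boole, Nat.cast_id]
  congr 1
  ext e
  rw [mem_outerAt, Finset.mem_filter]
  exact and_congr_right fun he => and_iff_right (hout e he)

end Witness

/-! ### Attaching negative loops at every vertex -/

/-- `G` with `|E(G)|` additional negative loops at every vertex. -/
def addLoops (G : SignedMultigraph) : SignedMultigraph where
  V := G.V
  E := G.E ⊕ (G.V × G.E)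
  ends := Sum.elim G.ends fun p => Sym2.diag p.1
  neg := Sum.elim G.neg fun _ => true

/-- The edge set of `G.addLoops` corresponding to an edge set of `G`. -/
def lift (S : Finset G.E) : Finset G.addLoops.E := S.map Function.Embedding.inl

theorem inl_mem_lift {S : Finset G.E} {e : G.E} : (Sum.inl e : G.addLoops.E) ∈ lift S ↔ e ∈ S := by
  constructor
  · intro h
    obtain ⟨f, hf, hfe⟩ := Finset.mem_map.1 h
    rwa [← Sum.inl_injective hfe]
  · exact fun h => Finset.mem_map.2 ⟨e, h, rfl⟩

theorem exists_of_mem_lift {S : Finset G.E} {f : G.addLoops.E} (h : f ∈ lift S) :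
    ∃ e ∈ S, f = Sum.inl e := by
  obtain ⟨e, he, rfl⟩ := Finset.mem_map.1 h
  exact ⟨e, he, rfl⟩

theorem exists_eq_lift {S : Finset G.E} {M : Finset G.addLoops.E} (h : M ⊆ lift S) :
    ∃ M' ⊆ S, M = lift M' := by
  obtain ⟨M', hM', rfl⟩ := Finset.subset_map_iff.1 h
  exact ⟨M', hM', rfl⟩

theorem lift_injective : Function.Injective (lift (G := G)) := Finset.map_injective _

theorem lift_union (S T : Finset G.E) : lift (S ∪ T) = lift S ∪ lift T := Finset.map_union _ _

theorem card_lift (S : Finset G.E) : (lift S).card = S.card := Finset.card_map _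

theorem disjoint_lift {S T : Finset G.E} : Disjoint (lift S) (lift T) ↔ Disjoint S T :=
  Finset.disjoint_map _

theorem filter_lift (S : Finset G.E) (p : G.addLoops.E → Prop) (q : G.E → Prop)
    {_ : DecidablePred p} {_ : DecidablePred q} (h : ∀ e, p (Sum.inl e) ↔ q e) :
    (lift S).filter p = lift (S.filter q) := by
  ext f
  rw [Finset.mem_filter]
  constructor
  · rintro ⟨hf, hp⟩
    obtain ⟨e, he, rfl⟩ := exists_of_mem_lift hf
    exact inl_mem_lift.2 (Finset.mem_filter.2 ⟨he, (h e).1 hp⟩)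
  · intro hf
    obtain ⟨e, he, rfl⟩ := exists_of_mem_lift hf
    obtain ⟨he, hq⟩ := Finset.mem_filter.1 he
    exact ⟨inl_mem_lift.2 he, (h e).2 hq⟩

theorem support_lift (S : Finset G.E) : G.addLoops.support (lift S) = G.support S := by
  ext v
  refine mem_support.trans (Iff.trans ?_ mem_support.symm)
  constructor
  · rintro ⟨f, hf, hv⟩
    obtain ⟨e, he, rfl⟩ := exists_of_mem_lift hf
    exact ⟨e, he, hv⟩
  · rintro ⟨e, he, hv⟩
    exact ⟨Sum.inl e, inl_mem_lift.2 he, hv⟩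

theorem degIn_lift (S : Finset G.E) (v : G.V) : G.addLoops.degIn (lift S) v = G.degIn S v :=
  Finset.sum_map _ _ _

theorem adj_lift {S : Finset G.E} {u v : G.V} : G.addLoops.Adj (lift S) u v ↔ G.Adj S u v := by
  constructor
  · rintro ⟨f, hf, hv⟩
    obtain ⟨e, he, rfl⟩ := exists_of_mem_lift hf
    exact ⟨e, he, hv⟩
  · rintro ⟨e, he, hv⟩
    exact ⟨Sum.inl e, inl_mem_lift.2 he, hv⟩

theorem reach_lift {S : Finset G.E} {u v : G.V} :
    G.addLoops.Reach (lift S) u v ↔ G.Reach S u v := by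
  have : G.addLoops.Adj (lift S) = G.Adj S := by
    funext u v
    exact propext adj_lift
  rw [Reach, Reach, this]
  rfl

theorem connOn_lift {S : Finset G.E} : G.addLoops.ConnOn (lift S) ↔ G.ConnOn S := by
  simp only [ConnOn, support_lift]
  exact forall₄_congr fun u _ v _ => reach_lift

theorem card_negEdges_lift (S : Finset G.E) :
    (G.addLoops.negEdges (lift S)).card = (G.negEdges S).card := by
  rw [negEdges, filter_lift S _ (fun e => G.neg e = true) fun _ => Iff.rfl, card_lift]
  rfl

theorem isCircuit_lift {S : Finset G.E} : G.addLoops.IsCircuit (lift S) ↔ G.IsCircuit S := by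
  simp only [IsCircuit, connOn_lift, support_lift]
  refine and_congr Finset.map_nonempty (and_congr_right fun _ => ?_)
  exact forall₂_congr fun v _ => iff_of_eq (congrArg (· = 2) (degIn_lift S v))

theorem isUnbalancedCircuit_lift {S : Finset G.E} :
    G.addLoops.IsUnbalancedCircuit (lift S) ↔ G.IsUnbalancedCircuit S := by
  rw [IsUnbalancedCircuit, IsUnbalancedCircuit, isCircuit_lift, card_negEdges_lift]

theorem isPath_lift {P : Finset G.E} {u v : G.V} :
    G.addLoops.IsPath (lift P) u v ↔ G.IsPath P u v := by
  have hdeg : ∀ w n, G.addLoops.degIn (lift P) w = n ↔ G.degIn P w = n := fun w n =>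
    iff_of_eq (congrArg (· = n) (degIn_lift P w))
  have hsup : ∀ w : G.V, w ∈ G.addLoops.support (lift P) ↔ w ∈ G.support P := fun w =>
    iff_of_eq (congrArg (w ∈ ·) (support_lift P))
  exact and_congr Finset.map_nonempty <| and_congr connOn_lift <| and_congr Iff.rfl <|
    and_congr (hsup u) <| and_congr (hsup v) <| and_congr (hdeg u 1) <| and_congr (hdeg v 1) <|
    forall_congr' fun w => imp_congr (hsup w) <| imp_congr Iff.rfl <| imp_congr Iff.rfl (hdeg w 2)

theorem isSignedCircuit_of_lift {M : Finset G.E} (h : G.addLoops.IsSignedCircuit (lift M)) :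
    G.IsSignedCircuit M := by
  rcases h with ⟨hC, hb⟩ | ⟨C₁, C₂, hC₁, hC₂, hd, hc, hM⟩ |
    ⟨C₁, C₂, P, u, v, hC₁, hC₂, hd, hP, hPC₁, hPC₂, hP₁, hP₂, hM⟩
  · exact Or.inl ⟨isCircuit_lift.1 hC, by rwa [card_negEdges_lift] at hb⟩
  · obtain ⟨C₁, -, rfl⟩ := exists_eq_lift (hM ▸ Finset.subset_union_left : C₁ ⊆ lift M)
    obtain ⟨C₂, -, rfl⟩ := exists_eq_lift (hM ▸ Finset.subset_union_right : C₂ ⊆ lift M)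
    rw [← lift_union] at hM
    rw [support_lift, support_lift] at hc
    exact Or.inr (Or.inl ⟨C₁, C₂, isUnbalancedCircuit_lift.1 hC₁, isUnbalancedCircuit_lift.1 hC₂,
      disjoint_lift.1 hd, hc, lift_injective hM⟩)
  · obtain ⟨C₁, -, rfl⟩ := exists_eq_lift (S := M) (M := C₁) (by
      rw [hM]
      exact Finset.subset_union_left.trans Finset.subset_union_left)
    obtain ⟨C₂, -, rfl⟩ := exists_eq_lift (S := M) (M := C₂) (by
      rw [hM]
      exact Finset.subset_union_right.trans Finset.subset_union_left)
    obtain ⟨P, -, rfl⟩ := exists_eq_lift (hM ▸ Finset.subset_union_right : P ⊆ lift M)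
    rw [← lift_union, ← lift_union] at hM
    rw [support_lift, support_lift] at hd hPC₁ hPC₂
    exact Or.inr (Or.inr ⟨C₁, C₂, P, u, v, isUnbalancedCircuit_lift.1 hC₁,
      isUnbalancedCircuit_lift.1 hC₂, hd, isPath_lift.1 hP, hPC₁, hPC₂, disjoint_lift.1 hP₁,
      disjoint_lift.1 hP₂, lift_injective hM⟩)

theorem hasSCDC_of_lift {S : Finset G.E} (h : G.addLoops.HasSCDC (lift S)) : G.HasSCDC S := by
  obtain ⟨F, hF, hF2⟩ := h
  let π : Finset G.addLoops.E → Finset G.E := fun M =>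
    Finset.univ.filter fun e => (Sum.inl e : G.addLoops.E) ∈ M
  have hπ : ∀ M e, e ∈ π M ↔ (Sum.inl e : G.addLoops.E) ∈ M := fun M e =>
    Finset.mem_filter.trans (and_iff_right (Finset.mem_univ e))
  refine ⟨F.map π, fun M hM => ?_, fun e he => ?_⟩
  · obtain ⟨N, hN, rfl⟩ := Multiset.mem_map.1 hM
    obtain ⟨hN1, hN2⟩ := hF N hN
    obtain ⟨N, hNS, rfl⟩ := exists_eq_lift hN2
    have : π (lift N) = N := Finset.ext fun e => (hπ _ e).trans inl_mem_lift
    rw [this]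
    exact ⟨isSignedCircuit_of_lift hN1, hNS⟩
  · refine Eq.trans ?_ (hF2 (Sum.inl e) (inl_mem_lift.2 he))
    rw [coverCount, Multiset.filter_map, Multiset.card_map]
    refine congrArg _ ?_
    convert Multiset.filter_congr fun M _ => hπ M e <;> exact Iff.rfl

theorem card_freeLoops_lift (S : Finset G.E) (w : G.V) :
    Fintype.card G.E ≤ (G.addLoops.freeLoops (lift S) w).card := by
  let f : G.E → G.addLoops.E := fun e => Sum.inr (w, e)
  have hf : Function.Injective f := fun a b h => congrArg Prod.snd (Sum.inr_injective h)
  rw [← Finset.card_univ, ← Finset.card_image_of_injective _ hf]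
  refine Finset.card_le_card fun l hl => ?_
  obtain ⟨e, -, rfl⟩ := Finset.mem_image.1 hl
  refine mem_freeLoops.2 ⟨⟨rfl, rfl⟩, fun h => ?_⟩
  obtain ⟨e', -, h⟩ := exists_of_mem_lift h
  exact Sum.inr_ne_inl h

theorem GenBarbellWitness.isClassBarbell {ℬ : Finset (Finset G.E)}
    (h : G.GenBarbellWitness Finset.univ ℬ) :
    G.addLoops.IsClassBarbell (G.classOf ℬ) (lift Finset.univ) := by
  have hinner : G.addLoops.innerEdges (G.classOf ℬ) (lift Finset.univ) =
      lift (G.innerEdges (G.classOf ℬ) Finset.univ) :=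
    filter_lift _ _ _ fun _ => Iff.rfl
  have houter : ∀ S i, G.addLoops.outerAt (G.classOf ℬ) (lift S) i =
      lift (G.outerAt (G.classOf ℬ) S i) := fun S i =>
    filter_lift S _ _ fun _ => Iff.rfl
  have hclass : ∀ i, G.addLoops.classEdges (G.classOf ℬ) (lift Finset.univ) i =
      lift (G.classEdges (G.classOf ℬ) Finset.univ i) := fun i =>
    filter_lift _ _ _ fun _ => Iff.rfl
  constructor
  · intro v
    rw [hinner]
    exact (congrArg Even (degIn_lift (G := G) _ v)).mpr (h.even v)
  · intro u _ v _ huv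
    rw [hinner]
    exact reach_lift.2 (h.reach huv)
  · intro i
    rw [hclass, houter, card_negEdges_lift, card_lift]
    exact h.parity i
  · intro F hF hne hout
    obtain ⟨F, -, rfl⟩ := exists_eq_lift hF
    obtain ⟨i, hi⟩ := h.acyclic (Finset.map_nonempty.1 hne)
      fun e he => hout (Sum.inl e) (inl_mem_lift.2 he)
    exact ⟨i, by rw [houter, card_lift, hi]⟩
  · intro w
    rw [card_lift, Finset.card_univ]
    exact card_freeLoops_lift (G := G) _ w

end SignedMultigraph

/-- Every generalized barbell has a signed circuit double cover. -/
theorem genBarbell_signed_circuit_double_cover (G : SignedMultigraph)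
    (hgb : G.IsGenBarbell Finset.univ) :
    ∃ F : Multiset (Finset G.E),
      (∀ S ∈ F, G.IsSignedCircuit S) ∧ ∀ e : G.E, G.coverCount F e = 2 := by
  obtain ⟨ℬ, hℬ⟩ := hgb
  obtain ⟨F, hF, hF2⟩ := SignedMultigraph.hasSCDC_of_lift
    (SignedMultigraph.IsClassBarbell.hasSCDC _ _ rfl hℬ.isClassBarbell)
  exact ⟨F, fun S hS => (hF S hS).1, fun e => hF2 e (Finset.mem_univ e)⟩
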